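/- arXiv:1112.1233 — 3 statements merged into one kernel-verified Lean document; each statement's English description precedes it below -/
import Mathlib

section
/- Let (p_t(x,·)) be an affine family of transition kernels on K with associated functions φ and ψ. Then φ and ψ satisfy the semi-flow property: φ(0,u) = 0, ψ(0,u) = u, and for all s,t ≥ 0 and u ∈ K*, φ(t+s,u) = φ(t,u) + φ(s,ψ(t,u)) and ψ(t+s,u) = ψ(s,ψ(t,u)) (in particular ψ(t,u) ∈ K*, so the right-hand sides are defined). -/
open MeasureTheory Filter Set
open scoped RealInnerProductSpace ENNReal Topology

variable {V : Type*} [NormedAddCommGroup V] [InnerProductSpace ℝ V] [FiniteDimensional ℝ V]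
  [MeasurableSpace V] [BorelSpace V]

/-- The closed dual cone of a set `K`. -/
def dualCone (K : Set V) : Set V := {u | ∀ x ∈ K, 0 ≤ ⟪x, u⟫}

/-- `K` is a proper (pointed) generating closed convex cone. -/
structure IsProperConvexCone (K : Set V) : Prop where
  isClosed : IsClosed K
  convex : Convex ℝ K
  smul_mem : ∀ (c : ℝ), 0 ≤ c → ∀ x ∈ K, c • x ∈ K
  proper : K ∩ (-K) = {0}
  generating : ∀ v : V, ∃ x ∈ K, ∃ y ∈ K, v = x - y

/-- An affine family of transition kernels on the cone `K`, with associated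
functions `φ` and `ψ`. -/
structure AffineTransitionFamily (K : Set V) (φ : ℝ → V → ℝ) (ψ : ℝ → V → V) where
  p : ℝ → V → Measure V
  measurable_p : ∀ t : ℝ, 0 ≤ t → ∀ A : Set V, MeasurableSet A →
      Measurable fun x => p t x A
  subprob : ∀ t : ℝ, 0 ≤ t → ∀ x ∈ K, p t x Set.univ ≤ 1
  supported : ∀ t : ℝ, 0 ≤ t → ∀ x ∈ K, p t x Kᶜ = 0
  init : ∀ x ∈ K, p 0 x = Measure.dirac x
  chapman : ∀ s t : ℝ, 0 ≤ s → 0 ≤ t → ∀ x ∈ K, ∀ A : Set V, MeasurableSet A →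
      p (t + s) x A = ∫⁻ ξ, p t ξ A ∂(p s x)
  weakCont : ∀ x ∈ K, ∀ f : BoundedContinuousFunction V ℝ,
      ContinuousOn (fun s => ∫ ξ, f ξ ∂(p s x)) (Set.Ici (0 : ℝ))
  laplace : ∀ t : ℝ, 0 ≤ t → ∀ u ∈ dualCone K, ∀ x ∈ K,
      ∫ ξ, Real.exp (-⟪u, ξ⟫) ∂(p t x) = Real.exp (-(φ t u) - ⟪ψ t u, x⟫)

theorem aux_zero_mem {K : Set V} (hK : IsProperConvexCone K) : (0 : V) ∈ K := by
  obtain ⟨x, hx, -⟩ := hK.generating 0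
  simpa using hK.smul_mem 0 le_rfl x hx

theorem aux_sep {K : Set V} (hK : IsProperConvexCone K) {a b : ℝ} {v w : V}
    (h : ∀ x ∈ K, a + ⟪v, x⟫ = b + ⟪w, x⟫) : a = b ∧ v = w := by
  have hab : a = b := by simpa using h 0 (aux_zero_mem hK)
  refine ⟨hab, ext_inner_right ℝ fun z => ?_⟩
  obtain ⟨x, hx, y, hy, rfl⟩ := hK.generating z
  have h1 := h x hx
  have h2 := h y hy
  rw [inner_sub_right, inner_sub_right]
  linarith

theorem aux_llaplace {K : Set V} {φ : ℝ → V → ℝ} {ψ : ℝ → V → V}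
    (X : AffineTransitionFamily K φ ψ) {t : ℝ} (ht : 0 ≤ t) {u : V} (hu : u ∈ dualCone K)
    {x : V} (hx : x ∈ K) :
    ∫⁻ ξ, ENNReal.ofReal (Real.exp (-⟪u, ξ⟫)) ∂(X.p t x)
      = ENNReal.ofReal (Real.exp (-(φ t u) - ⟪ψ t u, x⟫)) := by
  have h := X.laplace t ht u hu x hx
  have hi : Integrable (fun ξ => Real.exp (-⟪u, ξ⟫)) (X.p t x) := by
    by_contra hn
    rw [integral_undef hn] at h
    exact (Real.exp_pos _).ne h
  rw [← h, ofReal_integral_eq_lintegral_ofReal hi (ae_of_all _ fun _ => (Real.exp_pos _).le)]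

theorem aux_ae {K : Set V} {φ : ℝ → V → ℝ} {ψ : ℝ → V → V}
    (X : AffineTransitionFamily K φ ψ) {t : ℝ} (ht : 0 ≤ t) {x : V} (hx : x ∈ K) :
    ∀ᵐ ξ ∂(X.p t x), ξ ∈ K := X.supported t ht x hx

theorem aux_le {K : Set V} {φ : ℝ → V → ℝ} {ψ : ℝ → V → V}
    (X : AffineTransitionFamily K φ ψ) {t : ℝ} (ht : 0 ≤ t) {u : V} (hu : u ∈ dualCone K)
    {x : V} (hx : x ∈ K) : 0 ≤ φ t u + ⟪ψ t u, x⟫ := by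
  have h : ENNReal.ofReal (Real.exp (-(φ t u) - ⟪ψ t u, x⟫)) ≤ 1 := by
    rw [← aux_llaplace X ht hu hx]
    calc _ ≤ ∫⁻ _, 1 ∂(X.p t x) := by
          refine lintegral_mono_ae ?_
          filter_upwards [aux_ae X ht hx] with ξ hξ
          have := hu ξ hξ
          rw [real_inner_comm] at this
          rw [ENNReal.ofReal_le_one, Real.exp_le_one_iff]
          linarith
      _ ≤ 1 := by simpa using X.subprob t ht x hx
  rw [ENNReal.ofReal_le_one, Real.exp_le_one_iff] at h
  linarith

theorem aux_mem {K : Set V} (hK : IsProperConvexCone K) {φ : ℝ → V → ℝ} {ψ : ℝ → V → V}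
    (X : AffineTransitionFamily K φ ψ) {t : ℝ} (ht : 0 ≤ t) {u : V} (hu : u ∈ dualCone K) :
    ψ t u ∈ dualCone K := by
  intro x hx
  rw [real_inner_comm]
  by_contra! hn
  obtain ⟨n, hn'⟩ := exists_nat_gt (φ t u / (-⟪ψ t u, x⟫))
  rw [div_lt_iff₀ (by linarith)] at hn'
  have := aux_le X ht hu (hK.smul_mem n n.cast_nonneg x hx)
  rw [inner_smul_right] at this
  linarith

theorem aux_chapman {K : Set V} {φ : ℝ → V → ℝ} {ψ : ℝ → V → V}
    (X : AffineTransitionFamily K φ ψ) {s t : ℝ} (hs : 0 ≤ s) (ht : 0 ≤ t) {x : V} (hx : x ∈ K)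
    {f : V → ℝ≥0∞} (hf : Measurable f) :
    ∫⁻ ξ, f ξ ∂(X.p (t + s) x) = ∫⁻ ξ, ∫⁻ η, f η ∂(X.p t ξ) ∂(X.p s x) := by
  have hm : Measurable (X.p t) := Measure.measurable_of_measurable_coe _ (X.measurable_p t ht)
  have : X.p (t + s) x = (X.p s x).bind (X.p t) := by
    ext A hA
    rw [Measure.bind_apply hA hm.aemeasurable, X.chapman s t hs ht x hx A hA]
  rw [this, Measure.lintegral_bind hm.aemeasurable hf.aemeasurable]

/-- For an affine family of transition kernels on `K` with associated
functions `φ` and `ψ`, the functions satisfy the semi-flow property: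
`φ(0,u) = 0`, `ψ(0,u) = u`, and for all `s,t ≥ 0` and `u ∈ K*`,
`φ(t+s,u) = φ(t,u) + φ(s,ψ(t,u))` and `ψ(t+s,u) = ψ(s,ψ(t,u))`
(in particular `ψ(t,u) ∈ K*`). -/
theorem affine_phi_psi_semiflow
    {V : Type*} [NormedAddCommGroup V] [InnerProductSpace ℝ V] [FiniteDimensional ℝ V]
    [MeasurableSpace V] [BorelSpace V]
    (K : Set V) (hK : IsProperConvexCone K)
    (φ : ℝ → V → ℝ) (ψ : ℝ → V → V)
    (X : AffineTransitionFamily K φ ψ) :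
    (∀ u ∈ dualCone K, φ 0 u = 0 ∧ ψ 0 u = u) ∧
    ∀ s t : ℝ, 0 ≤ s → 0 ≤ t → ∀ u ∈ dualCone K,
      ψ t u ∈ dualCone K ∧
      φ (t + s) u = φ t u + φ s (ψ t u) ∧
      ψ (t + s) u = ψ s (ψ t u) := by
  refine ⟨fun u hu => ?_, fun s t hs ht u hu => ?_⟩
  · refine aux_sep hK fun x hx => ?_
    have h := X.laplace 0 le_rfl u hu x hx
    rw [X.init x hx, integral_dirac, Real.exp_eq_exp] at h
    linarith
  · have hψ := aux_mem hK X ht hu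
    refine ⟨hψ, aux_sep hK fun x hx => ?_⟩
    have h1 := aux_llaplace X (add_nonneg ht hs) hu hx
    have hmeas : ∀ v : V, Measurable fun ξ : V => ENNReal.ofReal (Real.exp (-⟪v, ξ⟫)) := fun v =>
      (Continuous.measurable (by fun_prop)).ennreal_ofReal
    have h2 : ∫⁻ ξ, ∫⁻ η, ENNReal.ofReal (Real.exp (-⟪u, η⟫)) ∂(X.p t ξ) ∂(X.p s x)
        = ∫⁻ ξ, ENNReal.ofReal (Real.exp (-(φ t u)))
            * ENNReal.ofReal (Real.exp (-⟪ψ t u, ξ⟫)) ∂(X.p s x) := by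
      refine lintegral_congr_ae ?_
      filter_upwards [aux_ae X hs hx] with ξ hξ
      rw [aux_llaplace X ht hu hξ, ← ENNReal.ofReal_mul (Real.exp_pos _).le, ← Real.exp_add,
        sub_eq_add_neg]
    rw [aux_chapman X hs ht hx (hmeas u), h2, lintegral_const_mul _ (hmeas _),
      aux_llaplace X hs hψ hx, ← ENNReal.ofReal_mul (Real.exp_pos _).le, ← Real.exp_add,
      ENNReal.ofReal_eq_ofReal_iff (Real.exp_pos _).le (Real.exp_pos _).le, Real.exp_eq_exp] at h1
    linarith
end

section
/- Let (p_t(x,·)) be an affine family of transition kernels on K with associated functions φ and ψ. Then φ and ψ are order preserving: for every t ≥ 0 and all u,v ∈ K* with u ⪯ v one has φ(t,u) ≤ φ(t,v) and ψ(t,u) ⪯ ψ(t,v). -/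
open MeasureTheory Filter Set
open scoped RealInnerProductSpace ENNReal Topology

variable {V : Type*} [NormedAddCommGroup V] [InnerProductSpace ℝ V] [FiniteDimensional ℝ V]
  [MeasurableSpace V] [BorelSpace V]

/-- For an affine family of transition kernels on `K` with associated
functions `φ` and `ψ`, both functions are order preserving: for every `t ≥ 0` and
`u,v ∈ K*` with `u ⪯ v` (i.e. `v - u ∈ K*`), one has `φ(t,u) ≤ φ(t,v)` and
`ψ(t,u) ⪯ ψ(t,v)`. -/
theorem affine_phi_psi_orderPreserving
    {V : Type*} [NormedAddCommGroup V] [InnerProductSpace ℝ V] [FiniteDimensional ℝ V]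
    [MeasurableSpace V] [BorelSpace V]
    (K : Set V) (hK : IsProperConvexCone K)
    (φ : ℝ → V → ℝ) (ψ : ℝ → V → V)
    (X : AffineTransitionFamily K φ ψ) :
    ∀ t : ℝ, 0 ≤ t → ∀ u ∈ dualCone K, ∀ v ∈ dualCone K, v - u ∈ dualCone K →
      φ t u ≤ φ t v ∧ ψ t v - ψ t u ∈ dualCone K := by
  intro t ht u hu v hv huv
  have h0 : (0 : V) ∈ K := by
    have : (0 : V) ∈ K ∩ (-K) := by rw [hK.proper]; rfl
    exact this.1
  have key : ∀ x ∈ K, φ t u + ⟪ψ t u, x⟫ ≤ φ t v + ⟪ψ t v, x⟫ := by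
    intro x hx
    haveI : IsFiniteMeasure (X.p t x) :=
      ⟨lt_of_le_of_lt (X.subprob t ht x hx) ENNReal.one_lt_top⟩
    have hae : ∀ᵐ ξ ∂(X.p t x), ξ ∈ K := X.supported t ht x hx
    have hint : ∀ w ∈ dualCone K, Integrable (fun ξ => Real.exp (-⟪w, ξ⟫)) (X.p t x) := by
      intro w hw
      refine Integrable.of_bound (C := 1)
        (Continuous.aestronglyMeasurable (by fun_prop)) ?_
      filter_upwards [hae] with ξ hξ
      have h1 := hw ξ hξ
      rw [real_inner_comm] at h1
      rw [Real.norm_eq_abs, abs_of_pos (Real.exp_pos _)]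
      exact Real.exp_le_one_iff.mpr (by linarith)
    have hle : ∫ ξ, Real.exp (-⟪v, ξ⟫) ∂(X.p t x) ≤ ∫ ξ, Real.exp (-⟪u, ξ⟫) ∂(X.p t x) := by
      refine integral_mono_ae (hint v hv) (hint u hu) ?_
      filter_upwards [hae] with ξ hξ
      have h1 := huv ξ hξ
      rw [real_inner_comm, inner_sub_left] at h1
      exact Real.exp_le_exp.mpr (by linarith)
    rw [X.laplace t ht u hu x hx, X.laplace t ht v hv x hx] at hle
    have := Real.exp_le_exp.mp hle
    linarith
  refine ⟨by simpa using key 0 h0, ?_⟩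
  intro x hx
  rw [real_inner_comm, inner_sub_left]
  by_contra hneg
  push Not at hneg
  set d := ⟪ψ t v, x⟫ - ⟪ψ t u, x⟫ with hd
  set a := φ t v - φ t u with ha
  have ha0 : 0 ≤ a := by
    have := key 0 h0
    simp at this
    linarith
  have hc : 0 ≤ (a + 1) / (-d) := div_nonneg (by linarith) (by linarith)
  have h2 := key _ (hK.smul_mem _ hc x hx)
  rw [inner_smul_right, inner_smul_right] at h2
  have h3 : (a + 1) / (-d) * d = -(a + 1) := by
    have : d ≠ 0 := hneg.ne
    field_simp
  have h4 : (a + 1) / (-d) * d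
      = (a + 1) / (-d) * ⟪ψ t v, x⟫ - (a + 1) / (-d) * ⟪ψ t u, x⟫ := by
    rw [← mul_sub]
  linarith
end

section
/- Let (p_t(x,·)) be an affine family of transition kernels on K with associated functions φ and ψ. Then the process is regular: the derivatives F(u) := ∂_t φ(t,u)|_{t=0} and R(u) := ∂_t ψ(t,u)|_{t=0} exist for every u ∈ K* and define continuous functions F : K* → ℝ and R : K* → V; moreover, for every u ∈ K* the maps t ↦ φ(t,u) and t ↦ ψ(t,u) are differentiable on ℝ₊ and satisfy the generalized Riccati equations ∂_t φ(t,u) = F(ψ(t,u)) with φ(0,u) = 0, and ∂_t ψ(t,u) = R(ψ(t,u)) with ψ(0,u) = u. -/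
open MeasureTheory Filter Set
open scoped RealInnerProductSpace ENNReal Topology

variable {V : Type*} [NormedAddCommGroup V] [InnerProductSpace ℝ V] [FiniteDimensional ℝ V]
  [MeasurableSpace V] [BorelSpace V]

set_option linter.unusedSectionVars false

namespace AffReg

variable {K : Set V} {φ : ℝ → V → ℝ} {ψ : ℝ → V → V}

/-- The Laplace transform. -/
noncomputable def Lp (X : AffineTransitionFamily K φ ψ) (t : ℝ) (x u : V) : ℝ :=
  ∫ ξ, Real.exp (-⟪u, ξ⟫) ∂(X.p t x)

lemma zero_mem (hK : IsProperConvexCone K) : (0:V) ∈ K := by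
  have : (0:V) ∈ K ∩ (-K) := by rw [hK.proper]; simp
  exact this.1

lemma add_mem (hK : IsProperConvexCone K) {x y : V} (hx : x ∈ K) (hy : y ∈ K) : x + y ∈ K := by
  have h := hK.convex hx hy (by norm_num : (0:ℝ) ≤ 1/2) (by norm_num : (0:ℝ) ≤ 1/2) (by norm_num)
  have h2 := hK.smul_mem 2 (by norm_num) _ h
  convert h2 using 1
  module

lemma dual_inner {u x : V} (hu : u ∈ dualCone K) (hx : x ∈ K) : 0 ≤ ⟪u, x⟫ := by
  rw [real_inner_comm]; exact hu x hx

lemma dual_add {u v : V} (hu : u ∈ dualCone K) (hv : v ∈ dualCone K) : u + v ∈ dualCone K := by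
  intro x hx
  rw [inner_add_right]
  exact add_nonneg (hu x hx) (hv x hx)

lemma dual_smul {u : V} {c : ℝ} (hc : 0 ≤ c) (hu : u ∈ dualCone K) : c • u ∈ dualCone K := by
  intro x hx
  rw [inner_smul_right]
  exact mul_nonneg hc (hu x hx)

lemma dual_zero : (0:V) ∈ dualCone K := by
  intro x hx; simp

lemma dual_closed : IsClosed (dualCone K) := by
  have : dualCone K = ⋂ x ∈ K, {u : V | 0 ≤ ⟪x, u⟫} := by
    ext u; simp [dualCone]
  rw [this]
  exact isClosed_biInter fun x _ => isClosed_le continuous_const (by fun_prop)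

lemma dual_convex : Convex ℝ (dualCone K) := by
  intro u hu v hv a b ha hb _
  exact dual_add (dual_smul ha hu) (dual_smul hb hv)

/-- norm domination for generating sets -/
lemma exists_dom {K' : Set V} (h0 : (0:V) ∈ K') (hadd : ∀ x ∈ K', ∀ y ∈ K', x + y ∈ K')
    (hgen : ∀ v : V, ∃ x ∈ K', ∃ y ∈ K', v = x - y) :
    ∃ z ∈ K', ∀ w ∈ dualCone K', ‖w‖ ≤ ⟪z, w⟫ := by
  let o := stdOrthonormalBasis ℝ V
  choose f hf g hg hfg using fun i => hgen (o i)
  have hs : ∀ s : Finset (Fin (Module.finrank ℝ V)), ∑ i ∈ s, (f i + g i) ∈ K' := by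
    intro s
    induction s using Finset.induction_on with
    | empty => simpa using h0
    | insert a s ha ih =>
      rw [Finset.sum_insert ha]
      exact hadd _ (hadd _ (hf a) _ (hg a)) _ ih
  refine ⟨∑ i, (f i + g i), hs _, ?_⟩
  intro w hw
  calc ‖w‖ = ‖∑ i, ⟪o i, w⟫ • o i‖ := by rw [o.sum_repr' w]
    _ ≤ ∑ i, ‖⟪o i, w⟫ • o i‖ := norm_sum_le _ _
    _ = ∑ i, |⟪o i, w⟫| := by
        refine Finset.sum_congr rfl fun i _ => ?_
        rw [norm_smul, o.norm_eq_one, mul_one, Real.norm_eq_abs]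
    _ ≤ ∑ i, ⟪f i + g i, w⟫ := by
        refine Finset.sum_le_sum fun i _ => ?_
        rw [hfg i, inner_sub_left, inner_add_left]
        have := hw _ (hf i)
        have := hw _ (hg i)
        rw [abs_le]; constructor <;> linarith
    _ = _ := by rw [sum_inner]

lemma bidual (hK : IsProperConvexCone K) {v : V} (hv : ∀ u ∈ dualCone K, 0 ≤ ⟪u, v⟫) : v ∈ K := by
  by_contra hvK
  obtain ⟨f, c, h1, h2⟩ := geometric_hahn_banach_point_closed hK.convex hK.isClosed hvK
  have hc : c < 0 := by simpa using h2 0 (zero_mem hK)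
  set u := (InnerProductSpace.toDual ℝ V).symm f with hu
  have hfu : ∀ x, f x = ⟪u, x⟫ := by
    intro x; rw [hu, InnerProductSpace.toDual_symm_apply]
  have : u ∈ dualCone K := by
    intro x hx
    rw [real_inner_comm, ← hfu]
    by_contra hneg
    push Not at hneg
    have := h2 ((c / f x) • x) (hK.smul_mem _ (div_nonneg_of_nonpos hc.le hneg.le) x hx)
    rw [map_smul, smul_eq_mul, div_mul_cancel₀ _ hneg.ne] at this
    exact lt_irrefl _ this
  have := hv u this
  rw [← hfu] at this
  linarith

lemma dual_gen (hK : IsProperConvexCone K) (v : V) :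
    ∃ x ∈ dualCone K, ∃ y ∈ dualCone K, v = x - y := by
  let S : Submodule ℝ V :=
    { carrier := {v | ∃ x ∈ dualCone K, ∃ y ∈ dualCone K, v = x - y}
      zero_mem' := ⟨0, dual_zero, 0, dual_zero, by simp⟩
      add_mem' := by
        rintro a b ⟨x, hx, y, hy, rfl⟩ ⟨x', hx', y', hy', rfl⟩
        exact ⟨x + x', dual_add hx hx', y + y', dual_add hy hy', by abel⟩
      smul_mem' := by
        rintro c a ⟨x, hx, y, hy, rfl⟩
        rcases le_total 0 c with hc | hc
        · exact ⟨c • x, dual_smul hc hx, c • y, dual_smul hc hy, by module⟩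
        · exact ⟨(-c) • y, dual_smul (by linarith) hy, (-c) • x, dual_smul (by linarith) hx,
            by module⟩ }
  have hS : Sᗮ = ⊥ := by
    rw [Submodule.eq_bot_iff]
    intro w hw
    have h1 : ∀ u ∈ dualCone K, ⟪u, w⟫ = 0 := by
      intro u hu
      exact (Submodule.mem_orthogonal S w).1 hw u ⟨u, hu, 0, dual_zero, by simp⟩
    have h2 : w ∈ K ∩ (-K) := by
      refine ⟨bidual hK fun u hu => (h1 u hu).ge, ?_⟩
      rw [Set.mem_neg]
      exact bidual hK fun u hu => by rw [inner_neg_right, h1 u hu]; simp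
    rw [hK.proper] at h2
    exact h2
  have : S = ⊤ := by rwa [Submodule.orthogonal_eq_bot_iff] at hS
  have hv : v ∈ S := by rw [this]; trivial
  exact hv

lemma exists_z (hK : IsProperConvexCone K) : ∃ z ∈ K, ∀ w ∈ dualCone K, ‖w‖ ≤ ⟪z, w⟫ :=
  exists_dom (zero_mem hK) (fun _ hx _ hy => add_mem hK hx hy) hK.generating

lemma exists_e (hK : IsProperConvexCone K) : ∃ e ∈ dualCone K, ∀ x ∈ K, ‖x‖ ≤ ⟪e, x⟫ := by
  obtain ⟨e, he, h⟩ := exists_dom (K' := dualCone K) dual_zero (fun _ hx _ hy => dual_add hx hy)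
    (dual_gen hK)
  refine ⟨e, he, fun x hx => h x ?_⟩
  intro u hu
  exact dual_inner hu hx

lemma le_of_norm {e : V} (he : ∀ x ∈ K, ‖x‖ ≤ ⟪e, x⟫) {w : V} {δ : ℝ} (hw : ‖w‖ ≤ δ) :
    δ • e + w ∈ dualCone K := by
  intro x hx
  rw [inner_add_right, inner_smul_right, real_inner_comm]
  have h1 := he x hx
  have h2 := abs_le.1 (abs_real_inner_le_norm x w)
  have h3 : ‖x‖ * ‖w‖ ≤ ‖x‖ * δ := by gcongr
  have h4 : ‖x‖ * δ ≤ δ * ⟪e, x⟫ := by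
    rw [mul_comm]; exact mul_le_mul_of_nonneg_left h1 ((norm_nonneg _).trans hw)
  linarith [h2.1]

lemma mem_int {e : V} (he : ∀ x ∈ K, ‖x‖ ≤ ⟪e, x⟫) {u : V} (hu : u ∈ dualCone K) {δ : ℝ}
    (hδ : 0 < δ) : u + δ • e ∈ interior (dualCone K) := by
  rw [mem_interior_iff_mem_nhds, Metric.mem_nhds_iff]
  refine ⟨δ, hδ, fun v hv => ?_⟩
  rw [mem_ball_iff_norm] at hv
  have := dual_add hu (le_of_norm he hv.le)
  convert this using 1
  abel

lemma int_sub (e : V) {u : V} (hu : u ∈ interior (dualCone K)) :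
    ∃ ε : ℝ, 0 < ε ∧ ∀ s ≤ ε, 0 ≤ s → u - s • e ∈ dualCone K := by
  have h : Tendsto (fun s : ℝ => u - s • e) (𝓝 0) (𝓝 u) := by
    have : Continuous (fun s : ℝ => u - s • e) := by fun_prop
    simpa using this.tendsto 0
  have h2 := h.eventually (mem_interior_iff_mem_nhds.1 hu)
  rw [Metric.eventually_nhds_iff] at h2
  obtain ⟨ε, hε, h2⟩ := h2
  refine ⟨ε/2, by positivity, fun s hs hs0 => h2 ?_⟩
  rw [Real.dist_eq, sub_zero, abs_of_nonneg hs0]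
  linarith

lemma int_convex : Convex ℝ (interior (dualCone K)) := dual_convex.interior

lemma int_mem {u : V} (hu : u ∈ interior (dualCone K)) : u ∈ dualCone K := interior_subset hu

lemma e_int {e : V} (he : ∀ x ∈ K, ‖x‖ ≤ ⟪e, x⟫) {δ : ℝ} (hδ : 0 < δ) :
   δ • e ∈ interior (dualCone K) := by
  simpa using mem_int he dual_zero hδ

/-- convergence tested on `K` -/
lemma tendsto_of_inner (hK : IsProperConvexCone K) {α : Type*} {l : Filter α} {f : α → V} {w : V}
    (h : ∀ x ∈ K, Tendsto (fun a => ⟪f a, x⟫) l (𝓝 ⟪w, x⟫)) : Tendsto f l (𝓝 w) := by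
  have h' : ∀ y : V, Tendsto (fun a => ⟪f a, y⟫) l (𝓝 ⟪w, y⟫) := by
    intro y
    obtain ⟨a, ha, b, hb, rfl⟩ := hK.generating y
    simp only [inner_sub_right]
    exact (h a ha).sub (h b hb)
  let o := stdOrthonormalBasis ℝ V
  have : f = fun a => ∑ i, ⟪f a, o i⟫ • o i := by
    ext a
    conv_lhs => rw [← o.sum_repr' (f a)]
    simp only [real_inner_comm]
  rw [this, ← o.sum_repr' w]
  refine tendsto_finsetSum _ fun i _ => ?_
  have := (h' (o i)).smul_const (o i)
  simpa only [real_inner_comm] using this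

lemma exists_tendsto_of_inner (hK : IsProperConvexCone K) {α : Type*} {l : Filter α} {f : α → V}
    (h : ∀ x ∈ K, ∃ c, Tendsto (fun a => ⟪f a, x⟫) l (𝓝 c)) : ∃ w, Tendsto f l (𝓝 w) := by
  have h' : ∀ y : V, ∃ c, Tendsto (fun a => ⟪f a, y⟫) l (𝓝 c) := by
    intro y
    obtain ⟨a, ha, b, hb, rfl⟩ := hK.generating y
    simp only [inner_sub_right]
    obtain ⟨c, hc⟩ := h a ha
    obtain ⟨d, hd⟩ := h b hb
    exact ⟨c - d, hc.sub hd⟩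
  let o := stdOrthonormalBasis ℝ V
  choose c hc using fun i => h' (o i)
  have : f = fun a => ∑ i, ⟪f a, o i⟫ • o i := by
    ext a
    conv_lhs => rw [← o.sum_repr' (f a)]
    simp only [real_inner_comm]
  rw [this]
  exact ⟨_, tendsto_finsetSum _ fun i _ => (hc i).smul_const (o i)⟩

section meas

variable {t : ℝ} {x u : V}

lemma Lp_eq (X : AffineTransitionFamily K φ ψ) (ht : 0 ≤ t) (hu : u ∈ dualCone K) (hx : x ∈ K) :
    Lp X t x u = Real.exp (-(φ t u) - ⟪ψ t u, x⟫) := X.laplace t ht u hu x hx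

lemma Lp_pos (X : AffineTransitionFamily K φ ψ) (ht : 0 ≤ t) (hu : u ∈ dualCone K) (hx : x ∈ K) : 0 < Lp X t x u := by
  rw [Lp_eq X ht hu hx]; exact Real.exp_pos _

lemma integ (X : AffineTransitionFamily K φ ψ) (ht : 0 ≤ t) (hu : u ∈ dualCone K) (hx : x ∈ K) :
    Integrable (fun ξ => Real.exp (-⟪u, ξ⟫)) (X.p t x) :=
  Integrable.of_integral_ne_zero (Lp_pos X ht hu hx).ne'

lemma aeK (X : AffineTransitionFamily K φ ψ) (ht : 0 ≤ t) (hx : x ∈ K) : ∀ᵐ ξ ∂(X.p t x), ξ ∈ K := by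
  rw [ae_iff]; exact X.supported t ht x hx

lemma fin (X : AffineTransitionFamily K φ ψ) (ht : 0 ≤ t) (hx : x ∈ K) : IsFiniteMeasure (X.p t x) :=
  ⟨(X.subprob t ht x hx).trans_lt (by simp)⟩

lemma Lp_anti (X : AffineTransitionFamily K φ ψ) (ht : 0 ≤ t) (hx : x ∈ K) {v : V} (hu : u ∈ dualCone K) (hv : v ∈ dualCone K)
    (huv : v - u ∈ dualCone K) : Lp X t x v ≤ Lp X t x u := by
  refine integral_mono_ae (integ X ht hv hx) (integ X ht hu hx) ?_
  filter_upwards [aeK X ht hx] with ξ hξ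
  have := dual_inner huv hξ
  rw [inner_sub_left] at this
  exact Real.exp_le_exp.2 (by linarith)

lemma Lp_le_one (X : AffineTransitionFamily K φ ψ) (ht : 0 ≤ t) (hx : x ∈ K) (hu : u ∈ dualCone K) : Lp X t x u ≤ 1 := by
  refine (Lp_anti X ht hx dual_zero hu (by simpa using hu)).trans ?_
  have : Lp X t x 0 = (X.p t x).real univ := by simp [Lp]
  rw [this]
  exact ENNReal.toReal_le_of_le_ofReal (by simp) (by simpa using X.subprob t ht x hx)

lemma Lp_sq (X : AffineTransitionFamily K φ ψ) (ht : 0 ≤ t) (hx : x ∈ K) (hu : u ∈ dualCone K) :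
    (Lp X t x u)^2 ≤ Lp X t x ((2:ℝ) • u) := by
  have h2u := dual_smul (K := K) (by norm_num : (0:ℝ) ≤ 2) hu
  set m := Lp X t x u with hm
  have h1 := integ X ht hu hx
  have h2 := integ X ht h2u hx
  have h0 := integ X ht dual_zero hx
  have hpos : 0 ≤ ∫ ξ, (Real.exp (-⟪u, ξ⟫) - m)^2 ∂(X.p t x) :=
    integral_nonneg fun ξ => sq_nonneg _
  have heq : ∫ ξ, (Real.exp (-⟪u, ξ⟫) - m)^2 ∂(X.p t x)
      = Lp X t x ((2:ℝ) • u) - 2 * m * m + m^2 * Lp X t x 0 := by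
    have : ∀ ξ : V, (Real.exp (-⟪u, ξ⟫) - m)^2 = Real.exp (-⟪(2:ℝ) • u, ξ⟫)
        - 2 * m * Real.exp (-⟪u, ξ⟫) + m^2 * Real.exp (-⟪(0:V), ξ⟫) := by
      intro ξ
      have : Real.exp (-⟪(2:ℝ) • u, ξ⟫) = Real.exp (-⟪u, ξ⟫) ^ 2 := by
        rw [← Real.exp_nat_mul, inner_smul_left]; congr 1; push_cast; simp
      rw [this]; simp; ring
    simp_rw [this]
    have h3 : Integrable (fun ξ => Real.exp (-⟪(2:ℝ) • u, ξ⟫) - 2 * m * Real.exp (-⟪u, ξ⟫))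
      (X.p t x) := h2.sub (h1.const_mul _)
    rw [integral_add h3 (h0.const_mul _),
      integral_sub h2 (h1.const_mul _), integral_const_mul, integral_const_mul]
    rfl
  have := Lp_le_one X ht hx (u := 0) dual_zero
  nlinarith [sq_nonneg m]

lemma Lp_convex (X : AffineTransitionFamily K φ ψ) (ht : 0 ≤ t) (hx : x ∈ K) :
    ConvexOn ℝ (dualCone K) (fun v => Real.exp ⟪v, x⟫ * Lp X t x v) := by
  refine ⟨dual_convex, ?_⟩
  intro u hu v hv a b ha hb hab
  have key : ∀ w : V, Real.exp ⟪w, x⟫ * Lp X t x w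
      = ∫ ξ, Real.exp (-⟪w, ξ - x⟫) ∂(X.p t x) := by
    intro w
    rw [Lp, ← integral_const_mul]
    congr 1; ext ξ
    rw [← Real.exp_add, inner_sub_right]; congr 1; ring
  have hint : ∀ w ∈ dualCone K, Integrable (fun ξ => Real.exp (-⟪w, ξ - x⟫)) (X.p t x) := by
    intro w hw
    refine ((integ X ht hw hx).const_mul (Real.exp ⟪w, x⟫)).congr (ae_of_all _ fun ξ => ?_)
    simp only
    rw [← Real.exp_add, inner_sub_right]; congr 1; ring
  simp only [key, smul_eq_mul]
  rw [← integral_const_mul, ← integral_const_mul,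
    ← integral_add ((hint u hu).const_mul a) ((hint v hv).const_mul b)]
  refine integral_mono (hint _ (dual_convex hu hv ha hb hab))
    (((hint u hu).const_mul a).add ((hint v hv).const_mul b)) fun ξ => ?_
  have := convexOn_exp.2 (mem_univ (-⟪u, ξ - x⟫)) (mem_univ (-⟪v, ξ - x⟫)) ha hb hab
  simp only [smul_eq_mul] at this
  refine le_trans (le_of_eq ?_) this
  congr 1
  rw [inner_add_left, inner_smul_left, inner_smul_left]; simp; ring

lemma Lp_cont_t (X : AffineTransitionFamily K φ ψ) (hu : u ∈ dualCone K) (hx : x ∈ K) :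
    ContinuousOn (fun t => Lp X t x u) (Ici 0) := by
  let f : BoundedContinuousFunction V ℝ := BoundedContinuousFunction.ofNormedAddCommGroup
    (fun ξ => Real.exp (-(max ⟪u, ξ⟫ 0))) (by fun_prop) 1 (by
      intro ξ
      rw [Real.norm_eq_abs, abs_of_pos (Real.exp_pos _), Real.exp_le_one_iff]
      simp)
  refine (X.weakCont x hx f).congr ?_
  intro t ht
  refine integral_congr_ae ?_
  filter_upwards [aeK X ht hx] with ξ hξ
  have := dual_inner hu hξ
  simp [f, this]

lemma Lp_cont_u (X : AffineTransitionFamily K φ ψ) (ht : 0 ≤ t) (hx : x ∈ K) :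
    ContinuousOn (fun u => Lp X t x u) (dualCone K) := by
  have := fin X ht hx
  intro u hu
  refine tendsto_integral_filter_of_dominated_convergence (fun _ => (1:ℝ)) ?_ ?_
    (integrable_const _) ?_
  · exact Eventually.of_forall fun v => by
      have : Continuous fun ξ : V => Real.exp (-⟪v, ξ⟫) := by fun_prop
      exact this.aestronglyMeasurable
  · filter_upwards [self_mem_nhdsWithin] with v hv
    filter_upwards [aeK X ht hx] with ξ hξ
    rw [Real.norm_eq_abs, abs_of_pos (Real.exp_pos _), Real.exp_le_one_iff]
    linarith [dual_inner hv hξ]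
  · refine ae_of_all _ fun ξ => ?_
    have : Continuous fun v : V => Real.exp (-⟪v, ξ⟫) := by fun_prop
    exact (this.tendsto u).mono_left nhdsWithin_le_nhds

lemma Lp_lint (X : AffineTransitionFamily K φ ψ) (ht : 0 ≤ t) (hu : u ∈ dualCone K) (hx : x ∈ K) :
    ∫⁻ ξ, ENNReal.ofReal (Real.exp (-⟪u, ξ⟫)) ∂(X.p t x) = ENNReal.ofReal (Lp X t x u) := by
  rw [Lp, ofReal_integral_eq_lintegral_ofReal (integ X ht hu hx)
    (ae_of_all _ fun ξ => (Real.exp_pos _).le)]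

lemma psi_mem (X : AffineTransitionFamily K φ ψ) (hK : IsProperConvexCone K) (ht : 0 ≤ t) (hu : u ∈ dualCone K) :
    ψ t u ∈ dualCone K := by
  intro x hx
  rw [real_inner_comm]
  by_contra hneg
  push Not at hneg
  obtain ⟨n, hn⟩ := exists_nat_gt (φ t u / (-⟪ψ t u, x⟫))
  have h := Lp_le_one X ht (hK.smul_mem n (by positivity) x hx) hu
  rw [Lp_eq X ht hu (hK.smul_mem n (by positivity) x hx), Real.exp_le_one_iff,
    inner_smul_right] at h
  rw [div_lt_iff₀ (by linarith)] at hn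
  linarith

lemma phi_nonneg (X : AffineTransitionFamily K φ ψ) (hK : IsProperConvexCone K) (ht : 0 ≤ t) (hu : u ∈ dualCone K) :
    0 ≤ φ t u := by
  have h := Lp_le_one X ht (zero_mem hK) hu
  rw [Lp_eq X ht hu (zero_mem hK), Real.exp_le_one_iff] at h
  simpa using h

/-- recover `ψ` from affine identity. -/
lemma eq_of_affine (hK : IsProperConvexCone K) {a b : ℝ} {v w : V}
    (h : ∀ x ∈ K, a + ⟪v, x⟫ = b + ⟪w, x⟫) : a = b ∧ v = w := by
  have hab : a = b := by simpa using h 0 (zero_mem hK)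
  refine ⟨hab, ?_⟩
  have h2 : ∀ y : V, ⟪v, y⟫ = ⟪w, y⟫ := by
    intro y
    obtain ⟨c, hc, d, hd, rfl⟩ := hK.generating y
    have := h c hc
    have := h d hd
    rw [inner_sub_right, inner_sub_right]; linarith
  exact ext_inner_right ℝ h2

lemma flow0 (X : AffineTransitionFamily K φ ψ) (hK : IsProperConvexCone K) (hu : u ∈ dualCone K) : φ 0 u = 0 ∧ ψ 0 u = u := by
  refine eq_of_affine hK fun x hx => ?_
  have h := Lp_eq X le_rfl hu hx
  rw [Lp, X.init x hx, integral_dirac, Real.exp_eq_exp] at h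
  linarith

lemma flow (X : AffineTransitionFamily K φ ψ) (hK : IsProperConvexCone K) {s : ℝ} (hs : 0 ≤ s) (ht : 0 ≤ t) (hu : u ∈ dualCone K) :
    φ (t + s) u = φ t u + φ s (ψ t u) ∧ ψ (t + s) u = ψ s (ψ t u) := by
  have hψ := psi_mem X hK ht hu
  refine eq_of_affine hK fun x hx => ?_
  have hmeas : Measurable (X.p t) := Measure.measurable_of_measurable_coe _ (X.measurable_p t ht)
  have hb : X.p (t + s) x = Measure.bind (X.p s x) (X.p t) := by
    ext A hA
    rw [Measure.bind_apply hA hmeas.aemeasurable, X.chapman s t hs ht x hx A hA]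
  have h1 := Lp_lint X (add_nonneg ht hs) hu hx
  have hfm : Measurable fun ξ : V => ENNReal.ofReal (Real.exp (-⟪u, ξ⟫)) := by
    have : Continuous fun ξ : V => Real.exp (-⟪u, ξ⟫) := by fun_prop
    exact ENNReal.measurable_ofReal.comp this.measurable
  rw [hb, Measure.lintegral_bind hmeas.aemeasurable hfm.aemeasurable] at h1
  have h2 : ∫⁻ ξ, ∫⁻ ζ, ENNReal.ofReal (Real.exp (-⟪u, ζ⟫)) ∂(X.p t ξ) ∂(X.p s x)
      = ∫⁻ ξ, ENNReal.ofReal (Real.exp (-φ t u)) * ENNReal.ofReal (Real.exp (-⟪ψ t u, ξ⟫))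
        ∂(X.p s x) := by
    refine lintegral_congr_ae ?_
    filter_upwards [aeK X hs hx] with ξ hξ
    rw [Lp_lint X ht hu hξ, Lp_eq X ht hu hξ, ← ENNReal.ofReal_mul (Real.exp_pos _).le,
      ← Real.exp_add, sub_eq_add_neg]
  rw [h2, lintegral_const_mul' _ _ ENNReal.ofReal_ne_top, Lp_lint X hs hψ hx,
    ← ENNReal.ofReal_mul (Real.exp_pos _).le, ENNReal.ofReal_eq_ofReal_iff (by
      have := Lp_pos X hs hψ hx
      positivity) (Lp_pos X (add_nonneg ht hs) hu hx).le,
    Lp_eq X hs hψ hx, Lp_eq X (add_nonneg ht hs) hu hx, ← Real.exp_add, Real.exp_eq_exp] at h1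
  linarith

lemma affine_eq_log (X : AffineTransitionFamily K φ ψ) (ht : 0 ≤ t) (hu : u ∈ dualCone K) (hx : x ∈ K) :
    φ t u + ⟪ψ t u, x⟫ = - Real.log (Lp X t x u) := by
  rw [Lp_eq X ht hu hx, Real.log_exp]; ring

lemma phi_cont_t (X : AffineTransitionFamily K φ ψ) (hK : IsProperConvexCone K) (hu : u ∈ dualCone K) :
    ContinuousOn (fun t => φ t u) (Ici 0) := by
  have h := ((Lp_cont_t X hu (zero_mem hK)).log
    (fun t ht => (Lp_pos X ht hu (zero_mem hK)).ne')).neg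
  refine h.congr fun t ht => ?_
  simpa using affine_eq_log X ht hu (zero_mem hK)

lemma psi_cont_t (X : AffineTransitionFamily K φ ψ) (hK : IsProperConvexCone K) (hu : u ∈ dualCone K) :
    ContinuousOn (fun t => ψ t u) (Ici 0) := by
  intro s hs
  refine tendsto_of_inner hK fun x hx => ?_
  have h := (((Lp_cont_t X hu hx).log (fun t ht => (Lp_pos X ht hu hx).ne')).neg).sub
    (phi_cont_t X hK hu)
  have h' : ContinuousOn (fun t => ⟪ψ t u, x⟫) (Ici 0) := by
    refine h.congr fun t ht => ?_
    have := affine_eq_log X ht hu hx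
    simp only [Pi.neg_apply, Pi.sub_apply]
    linarith
  exact h' s hs

lemma phi_cont_u (X : AffineTransitionFamily K φ ψ) (hK : IsProperConvexCone K) (ht : 0 ≤ t) :
    ContinuousOn (fun u => φ t u) (dualCone K) := by
  have h := ((Lp_cont_u X ht (zero_mem hK)).log
    (fun u hu => (Lp_pos X ht hu (zero_mem hK)).ne')).neg
  refine h.congr fun u hu => ?_
  simpa using affine_eq_log X ht hu (zero_mem hK)

lemma psi_cont_u (X : AffineTransitionFamily K φ ψ) (hK : IsProperConvexCone K) (ht : 0 ≤ t) :
    ContinuousOn (fun u => ψ t u) (dualCone K) := by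
  intro s hs
  refine tendsto_of_inner hK fun x hx => ?_
  have h := (((Lp_cont_u X ht hx).log (fun u hu => (Lp_pos X ht hu hx).ne')).neg).sub
    (phi_cont_u X hK ht)
  have h' : ContinuousOn (fun u => ⟪ψ t u, x⟫) (dualCone K) := by
    refine h.congr fun u hu => ?_
    have := affine_eq_log X ht hu hx
    simp only [Pi.neg_apply, Pi.sub_apply]
    linarith
  exact h' s hs

/-- an affine inequality on the cone gives an inequality for the linear parts -/
lemma le_of_affine (hK : IsProperConvexCone K) {a b : ℝ} {v w : V}
    (h : ∀ x ∈ K, a + ⟪v, x⟫ ≤ b + ⟪w, x⟫) : w - v ∈ dualCone K := by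
  intro x hx
  rw [real_inner_comm, inner_sub_left]
  by_contra hneg
  push Not at hneg
  obtain ⟨n, hn⟩ := exists_nat_gt ((b - a) / (-(⟪w, x⟫ - ⟪v, x⟫)))
  have h := h _ (hK.smul_mem n (by positivity) x hx)
  rw [inner_smul_right, inner_smul_right] at h
  rw [div_lt_iff₀ (by linarith)] at hn
  nlinarith

lemma psi_mono (X : AffineTransitionFamily K φ ψ) (hK : IsProperConvexCone K) (ht : 0 ≤ t) {v : V} (hu : u ∈ dualCone K)
    (hv : v ∈ dualCone K) (huv : v - u ∈ dualCone K) : ψ t v - ψ t u ∈ dualCone K := by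
  refine le_of_affine (a := φ t u) (b := φ t v) hK fun x hx => ?_
  rw [affine_eq_log X ht hu hx, affine_eq_log X ht hv hx]
  have := Real.log_le_log (Lp_pos X ht hv hx) (Lp_anti X ht hx hu hv huv)
  linarith

lemma psi_two (X : AffineTransitionFamily K φ ψ) (hK : IsProperConvexCone K) (ht : 0 ≤ t) (hu : u ∈ dualCone K) :
    (2:ℝ) • ψ t u - ψ t ((2:ℝ) • u) ∈ dualCone K := by
  have h2u := dual_smul (K := K) (by norm_num : (0:ℝ) ≤ 2) hu
  refine le_of_affine (a := φ t ((2:ℝ) • u)) (b := 2 * φ t u) hK fun x hx => ?_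
  have h1 := affine_eq_log X ht hu hx
  have h2 := affine_eq_log X ht h2u hx
  have h3 := Real.log_le_log (pow_pos (Lp_pos X ht hu hx) 2) (Lp_sq X ht hx hu)
  rw [Real.log_pow] at h3
  push_cast at h3
  rw [inner_smul_left]
  simp only [conj_trivial]
  linarith

lemma psi_pow (X : AffineTransitionFamily K φ ψ) (hK : IsProperConvexCone K) (ht : 0 ≤ t) (n : ℕ) (hu : u ∈ dualCone K) :
    (2:ℝ)^n • ψ t u - ψ t ((2:ℝ)^n • u) ∈ dualCone K := by
  induction n with
  | zero => simpa using dual_zero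
  | succ n ih =>
    have h1 := psi_two X hK ht (dual_smul (K := K) (by positivity : (0:ℝ) ≤ 2^n) hu)
    have h2 := dual_add h1 (dual_smul (by norm_num : (0:ℝ) ≤ 2) ih)
    convert h2 using 1
    rw [pow_succ', mul_smul, mul_smul]; module

/-- interior invariance for small times -/
lemma psi_int_small (X : AffineTransitionFamily K φ ψ) (hK : IsProperConvexCone K) :
    ∃ τ > 0, ∀ t, 0 ≤ t → t < τ → ∀ u ∈ interior (dualCone K), ψ t u ∈ interior (dualCone K) := by
  obtain ⟨e, heK, he⟩ := exists_e hK
  have hei : e ∈ interior (dualCone K) := by simpa using e_int he one_pos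
  have hc := psi_cont_t X hK heK 0 (by simp : (0:ℝ) ∈ Ici 0)
  rw [ContinuousWithinAt, (flow0 X hK heK).2] at hc
  have hev := hc.eventually (isOpen_interior.mem_nhds hei)
  rw [eventually_iff, Metric.mem_nhdsWithin_iff] at hev
  obtain ⟨τ, hτ, hev⟩ := hev
  refine ⟨τ, hτ, fun t ht htτ u hu => ?_⟩
  have hte : ψ t e ∈ interior (dualCone K) := by
    refine hev ⟨?_, ht⟩
    rw [Metric.mem_ball, Real.dist_eq, sub_zero, abs_of_nonneg ht]; exact htτ
  obtain ⟨ε, hε, hε2⟩ := int_sub e hte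
  obtain ⟨η, hη, hη2⟩ := int_sub e hu
  obtain ⟨n, hn⟩ := pow_unbounded_of_one_lt (1/η) (by norm_num : (1:ℝ) < 2)
  have hp : (0:ℝ) < 2^n := by positivity
  -- e ⪯ 2^n u
  have h1 : (2:ℝ)^n • u - e ∈ dualCone K := by
    have h := hη2 (1/2^n) (by
      rw [div_le_iff₀ hp]
      rw [div_lt_iff₀ hη] at hn
      linarith) (by positivity)
    have := dual_smul hp.le h
    rw [smul_sub, smul_smul, mul_one_div_cancel hp.ne', one_smul] at this
    exact this
  have h2 := psi_mono X hK ht heK (dual_smul hp.le (int_mem hu)) h1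
  have h3 := psi_pow X hK ht n (int_mem hu)
  have h4 := dual_add (dual_add h2 h3) (hε2 ε le_rfl hε.le)
  have h5 := mem_int he (dual_smul (inv_nonneg.2 hp.le) h4) (δ := ((2:ℝ)^n)⁻¹ * ε) (by positivity)
  convert h5 using 1
  have : ψ t ((2:ℝ)^n • u) - ψ t e + ((2:ℝ)^n • ψ t u - ψ t ((2:ℝ)^n • u)) + (ψ t e - ε • e)
    = (2:ℝ)^n • ψ t u - ε • e := by abel
  rw [this, smul_sub, smul_smul, smul_smul, inv_mul_cancel₀ hp.ne', one_smul, sub_add_cancel]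

lemma psi_int (X : AffineTransitionFamily K φ ψ) (hK : IsProperConvexCone K) (ht : 0 ≤ t) (hu : u ∈ interior (dualCone K)) :
    ψ t u ∈ interior (dualCone K) := by
  obtain ⟨τ, hτ, h⟩ := psi_int_small X hK
  obtain ⟨n, hn⟩ := exists_nat_gt (t / τ)
  have hn0 : (0:ℝ) < n := lt_of_le_of_lt (by positivity) hn
  set s := t / n with hs
  have hs0 : 0 ≤ s := by positivity
  have hsτ : s < τ := by
    rw [hs, div_lt_iff₀ hn0]; rwa [div_lt_iff₀ hτ, mul_comm] at hn
  have : ∀ k : ℕ, ψ (k * s) u ∈ interior (dualCone K) := by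
    intro k
    induction k with
    | zero => simpa [(flow0 X hK (int_mem hu)).2] using hu
    | succ k ih =>
      have := (flow X hK hs0 (by positivity : 0 ≤ (k:ℝ) * s) (int_mem hu)).2
      rw [show ((k + 1 : ℕ) : ℝ) * s = k * s + s by push_cast; ring, this]
      exact h s hs0 hsτ _ ih
  have h2 := this n
  rwa [hs, mul_div_cancel₀ _ hn0.ne'] at h2

end meas

/-- differentiability at zero of an almost additive curve -/
lemma curve_deriv {E : Type*} [NormedAddCommGroup E] [NormedSpace ℝ E] [CompleteSpace E]
    {c : ℝ → E} (hc : ContinuousOn c (Ici 0))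
    (H : ∀ ε > 0, ∃ δ > 0, ∀ r t : ℝ, 0 ≤ r → r ≤ δ → 0 ≤ t → t ≤ δ →
      ‖(c (t + r) - c 0) - (c t - c 0) - (c r - c 0)‖ ≤ ε * ‖c t - c 0‖) :
    ∃ d, HasDerivWithinAt c d (Ici 0) 0 := by
  set b : ℝ → E := fun t => c t - c 0 with hb
  have hbc : ContinuousOn b (Ici 0) := hc.sub continuousOn_const
  have hb0 : b 0 = 0 := by simp [hb]
  set q : ℝ → E := fun t => t⁻¹ • b t with hq
  have step1 : ∀ ε δ : ℝ, 0 ≤ ε → (∀ r t : ℝ, 0 ≤ r → r ≤ δ → 0 ≤ t → t ≤ δ →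
      ‖b (t + r) - b t - b r‖ ≤ ε * ‖b t‖) → ∀ t : ℝ, 0 < t → ∀ n : ℕ, n * t ≤ δ →
      ‖b (n * t) - (n:ℝ) • b t‖ ≤ n * (ε * ‖b t‖) := by
    intro ε δ hε h t ht n
    induction n with
    | zero => intro _; simp [hb0]
    | succ n ih =>
      intro hn
      push_cast at hn ⊢
      have hnt : 0 ≤ (n:ℝ) * t := by positivity
      have h1 := ih (by nlinarith)
      have h2 := h (n * t) t hnt (by nlinarith) ht.le (by nlinarith)
      have : b ((n + 1) * t) - ((n:ℝ) + 1) • b t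
        = (b (t + n * t) - b t - b (n * t)) + (b (n * t) - (n:ℝ) • b t) := by
        rw [show ((n:ℝ) + 1) * t = t + n * t by ring]; module
      rw [this]
      refine (norm_add_le _ _).trans ?_
      linarith
  have step2 : ∀ ε δ : ℝ, 0 ≤ ε → (∀ r t : ℝ, 0 ≤ r → r ≤ δ → 0 ≤ t → t ≤ δ →
      ‖b (t + r) - b t - b r‖ ≤ ε * ‖b t‖) → ∀ t : ℝ, 0 < t → ∀ n : ℕ, 0 < n → n * t ≤ δ →
      ‖q (n * t) - q t‖ ≤ ε * ‖q t‖ := by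
    intro ε δ hε h t ht n hn hnt
    have h1 := step1 ε δ hε h t ht n hnt
    have hn' : (0:ℝ) < n := by exact_mod_cast hn
    have h2 : q (n * t) - q t = ((n:ℝ) * t)⁻¹ • (b (n * t) - (n:ℝ) • b t) := by
      simp only [hq]
      rw [smul_sub _ (b (n * t)), smul_smul]
      congr 2
      field_simp
    rw [h2, norm_smul, Real.norm_eq_abs, abs_of_pos (by positivity)]
    calc ((n:ℝ) * t)⁻¹ * ‖b (n * t) - (n:ℝ) • b t‖ ≤ ((n:ℝ) * t)⁻¹ * (n * (ε * ‖b t‖)) := by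
          gcongr
      _ = ε * (t⁻¹ * ‖b t‖) := by field_simp
      _ = ε * ‖q t‖ := by
          simp only [hq]; rw [norm_smul, Real.norm_eq_abs, abs_of_pos (by positivity)]
  have hfloor : ∀ S t : ℝ, 0 < t → t ≤ S → ∃ n : ℕ, 0 < n ∧ n * t ≤ S ∧ S - t < n * t := by
    intro S t ht hS
    refine ⟨⌊S / t⌋₊, ?_, ?_, ?_⟩
    · rw [Nat.floor_pos, le_div_iff₀ ht]; linarith
    · rw [← le_div_iff₀ ht]; exact Nat.floor_le (div_nonneg (ht.le.trans hS) ht.le)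
    · have := Nat.lt_floor_add_one (S / t)
      rw [div_lt_iff₀ ht] at this
      linarith
  obtain ⟨δ₁, hδ₁, H₁⟩ := H (1/2) (by norm_num)
  have hcomp : IsCompact (Icc (0:ℝ) δ₁) := isCompact_Icc
  obtain ⟨B, hB⟩ := hcomp.exists_bound_of_continuousOn (hbc.mono Icc_subset_Ici_self)
  have hB0 : 0 ≤ B := (norm_nonneg _).trans (hB 0 ⟨le_rfl, hδ₁.le⟩)
  set C := 2 * ((δ₁ / 2)⁻¹ * B) with hC
  have hC0 : 0 ≤ C := by positivity
  have hqC : ∀ t, 0 < t → t ≤ δ₁ → ‖q t‖ ≤ C := by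
    intro t ht htδ
    obtain ⟨n, hn, hn1, hn2⟩ := hfloor δ₁ t ht htδ
    have h1 := step2 (1/2) δ₁ (by norm_num) H₁ t ht n hn hn1
    have hn' : (1:ℝ) ≤ n := by exact_mod_cast hn
    have hnt : δ₁ / 2 ≤ n * t := by nlinarith
    have h2 : ‖q (n * t)‖ ≤ (δ₁ / 2)⁻¹ * B := by
      simp only [hq]
      rw [norm_smul, Real.norm_eq_abs, abs_of_pos (by positivity)]
      gcongr
      exact hB _ ⟨by positivity, hn1⟩
    have h3 : ‖q t‖ ≤ ‖q (n * t)‖ + ‖q (n * t) - q t‖ := by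
      have := norm_sub_le (q (n * t)) (q (n * t) - q t)
      simpa using this
    rw [hC]; linarith
  have hcau : Cauchy (map q (𝓝[>] 0)) := by
    rw [Metric.cauchy_iff]
    refine ⟨inferInstance, fun ε hε => ?_⟩
    obtain ⟨δ₂, hδ₂, H₂⟩ := H (ε / (4 * (C + 1))) (by positivity)
    set S := min δ₁ δ₂ with hS
    have hS0 : 0 < S := lt_min hδ₁ hδ₂
    have hqc : ContinuousWithinAt q (Ici 0) S := by
      refine ContinuousWithinAt.smul ?_ (hbc S hS0.le)
      exact (continuousAt_inv₀ hS0.ne').continuousWithinAt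
    obtain ⟨ρ, hρ, hqρ⟩ := Metric.continuousWithinAt_iff.1 hqc (ε/4) (by positivity)
    have key : ∀ t, 0 < t → t < min S ρ → ‖q t - q S‖ < ε / 2 := by
      intro t ht htm
      have htS : t ≤ S := (htm.trans_le (min_le_left _ _)).le
      have htρ : t < ρ := htm.trans_le (min_le_right _ _)
      obtain ⟨n, hn, hn1, hn2⟩ := hfloor S t ht htS
      have h1 := step2 _ δ₂ (by positivity) H₂ t ht n hn (hn1.trans (min_le_right _ _))
      have h2 := hqρ (x := n * t) (by simp; positivity) (by
        rw [Real.dist_eq, abs_lt]; constructor <;> linarith)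
      rw [dist_eq_norm] at h2
      have h3 := hqC t ht (htS.trans (min_le_left _ _))
      have h4 : ε / (4 * (C + 1)) * ‖q t‖ ≤ ε / 4 := by
        calc ε / (4 * (C + 1)) * ‖q t‖ ≤ ε / (4 * (C + 1)) * (C + 1) := by
              gcongr; linarith
          _ = ε / 4 := by field_simp
      have h5 : q t - q S = (q (n * t) - q S) - (q (n * t) - q t) := by abel
      rw [h5]
      refine (norm_sub_le _ _).trans_lt ?_
      linarith
    refine ⟨q '' Ioo 0 (min S ρ), image_mem_map (Ioo_mem_nhdsGT (lt_min hS0 hρ)), ?_⟩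
    rintro _ ⟨t, ht, rfl⟩ _ ⟨s, hs, rfl⟩
    have h1 := key t ht.1 ht.2
    have h2 := key s hs.1 hs.2
    rw [← dist_eq_norm] at h1 h2
    have := dist_triangle_right (q t) (q s) (q S)
    linarith
  obtain ⟨d, hd⟩ := cauchy_map_iff_exists_tendsto.1 hcau
  refine ⟨d, ?_⟩
  rw [← hasDerivWithinAt_Ioi_iff_Ici, hasDerivWithinAt_iff_tendsto_slope' (by simp)]
  refine hd.congr fun t => ?_
  simp [slope, hq, hb]

/-- Convex functions converging to zero have small Lipschitz constants. -/
lemma small_lip {C : Set V} (hC : IsOpen C) {h : ℝ → V → ℝ}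
    (hconv : ∀ r, 0 ≤ r → ConvexOn ℝ C (h r))
    (hlim : ∀ v ∈ C, Tendsto (fun r => h r v) (𝓝[≥] 0) (𝓝 0)) {u : V} (hu : u ∈ C)
    {ε : ℝ} (hε : 0 < ε) :
    ∀ᶠ p : ℝ × V in (𝓝[≥] 0) ×ˢ (𝓝 u), |h p.1 p.2| ≤ ε ∧
      |h p.1 p.2 - h p.1 u| ≤ ε * ‖p.2 - u‖ := by
  obtain ⟨b, hb1, hb2⟩ := exists_mem_interior_convexHull_affineBasis (hC.mem_nhds hu)
  obtain ⟨ρ, hρ, hball⟩ := Metric.mem_nhds_iff.1 (mem_interior_iff_mem_nhds.1 hb1)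
  set η := min (ε / 3) (ε * ρ / 16) with hη
  have hη0 : 0 < η := by positivity
  have hη1 : 3 * η ≤ ε := by have := min_le_left (ε / 3) (ε * ρ / 16); linarith
  have hη2 : 16 * η ≤ ε * ρ := by have := min_le_right (ε / 3) (ε * ρ / 16); linarith
  have hv : ∀ v ∈ C, ∀ᶠ r in 𝓝[≥] (0:ℝ), |h r v| < η := by
    intro v hv
    have := (hlim v hv).abs
    rw [abs_zero] at this
    exact this.eventually (gt_mem_nhds hη0)
  have hbC : ∀ i, b i ∈ C := fun i => hb2 (subset_convexHull _ _ (mem_range_self i))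
  have hall : ∀ᶠ r in 𝓝[≥] (0:ℝ), 0 ≤ r ∧ |h r u| < η ∧ ∀ i, |h r (b i)| < η := by
    refine (eventually_mem_nhdsWithin).and ((hv u hu).and ?_)
    rw [eventually_all]
    exact fun i => hv _ (hbC i)
  have hU : ∀ᶠ v in 𝓝 u, v ∈ Metric.ball u (ρ / 2) := Metric.ball_mem_nhds _ (by positivity)
  filter_upwards [hall.prod_mk hU] with p hp
  obtain ⟨r, v⟩ := p
  obtain ⟨⟨hr, hru, hri⟩, hvb⟩ := hp
  simp only at hr hru hri hvb ⊢
  have hup : ∀ w ∈ Metric.ball u ρ, h r w ≤ η := by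
    intro w hw
    obtain ⟨y, ⟨i, rfl⟩, hy⟩ := (hconv r hr).exists_ge_of_mem_convexHull
      (by rintro _ ⟨i, rfl⟩; exact hbC i) (hball hw)
    exact hy.trans ((le_abs_self _).trans (hri i).le)
  have hlow : ∀ w ∈ Metric.ball u ρ, -(3 * η) ≤ h r w := by
    intro w hw
    have hw' : (2:ℝ) • u - w ∈ Metric.ball u ρ := by
      rw [mem_ball_iff_norm] at hw ⊢
      rw [show (2:ℝ) • u - w - u = -(w - u) by module, norm_neg]; exact hw
    have h1 := (hconv r hr).2 (hb2 (hball hw)) (hb2 (hball hw')) (by norm_num : (0:ℝ) ≤ 1/2)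
      (by norm_num : (0:ℝ) ≤ 1/2) (by norm_num)
    rw [show (1/2:ℝ) • w + (1/2:ℝ) • ((2:ℝ) • u - w) = u by module] at h1
    simp only [smul_eq_mul] at h1
    have := hup _ hw'
    have := (abs_lt.1 hru).1
    linarith
  have habs : ∀ w ∈ Metric.ball u ρ, |h r w| ≤ 3 * η := fun w hw =>
    abs_le.2 ⟨hlow w hw, (hup w hw).trans (by linarith)⟩
  have hvb' : v ∈ Metric.ball u ρ := Metric.ball_subset_ball (by linarith) hvb
  refine ⟨(habs v hvb').trans hη1, ?_⟩
  have hsub : Metric.ball u ρ ⊆ C := fun w hw => hb2 (hball hw)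
  have hL := ((hconv r hr).subset hsub (convex_ball _ _)).lipschitzOnWith_of_abs_le
    (ε := ρ / 2) (by positivity) (M := 3 * η) (fun a ha => habs a ha)
  have := hL.dist_le_mul v (by convert hvb using 2; ring) u
    (by simp; linarith)
  rw [Real.dist_eq, dist_eq_norm] at this
  refine this.trans ?_
  gcongr
  rw [Real.coe_toNNReal _ (by positivity)]
  rw [div_le_iff₀ (by positivity)]
  linarith

lemma log_lip {a b : ℝ} (ha : 1 / 2 ≤ a) (hb : 1 / 2 ≤ b) :
    |Real.log a - Real.log b| ≤ 2 * |a - b| := by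
  have key : ∀ a b : ℝ, 1 / 2 ≤ a → 1 / 2 ≤ b → Real.log a - Real.log b ≤ 2 * |a - b| := by
    intro a b ha hb
    have hb0 : 0 < b := by linarith
    have ha0 : 0 < a := by linarith
    rw [← Real.log_div ha0.ne' hb0.ne']
    refine (Real.log_le_sub_one_of_pos (by positivity)).trans ?_
    rw [div_sub_one hb0.ne', div_le_iff₀ hb0]
    have := le_abs_self (a - b)
    nlinarith [abs_nonneg (a - b)]
  rw [abs_le]
  have h1 := key a b ha hb
  have h2 := key b a hb ha
  rw [abs_sub_comm b a] at h2
  constructor <;> linarith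

section interior_deriv

variable {t : ℝ} {x u : V}

lemma Lp_exp (X : AffineTransitionFamily K φ ψ) (ht : 0 ≤ t) (hu : u ∈ dualCone K) (hx : x ∈ K) :
    Real.exp ⟪u, x⟫ * Lp X t x u = Real.exp (-(φ t u + ⟪ψ t u - u, x⟫)) := by
  rw [Lp_eq X ht hu hx, ← Real.exp_add, inner_sub_left]; congr 1; ring

lemma affine_small (X : AffineTransitionFamily K φ ψ) (hK : IsProperConvexCone K)
    (hu : u ∈ interior (dualCone K)) (hx : x ∈ K) {ε : ℝ} (hε : 0 < ε) :
    ∀ᶠ p : ℝ × V in (𝓝[≥] 0) ×ˢ (𝓝 u),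
      |(φ p.1 p.2 + ⟪ψ p.1 p.2 - p.2, x⟫) - (φ p.1 u + ⟪ψ p.1 u - u, x⟫)| ≤ ε * ‖p.2 - u‖ := by
  have h1 := small_lip (C := interior (dualCone K)) isOpen_interior
    (h := fun r v => Real.exp ⟪v, x⟫ * Lp X r x v - 1)
    (fun r hr => by
      have h := ((Lp_convex X hr hx).subset interior_subset int_convex)
      exact h.add_const (-1))
    (fun v hv => by
      have h := (Lp_cont_t X (int_mem hv) hx 0 (by simp)).const_mul (Real.exp ⟪v, x⟫)
      have h2 := h.tendsto.sub_const 1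
      have h3 : Real.exp ⟪v, x⟫ * Lp X 0 x v - 1 = 0 := by
        rw [Lp_exp X le_rfl (int_mem hv) hx, (flow0 X hK (int_mem hv)).1,
          (flow0 X hK (int_mem hv)).2]; simp
      rw [h3] at h2
      exact h2) hu (ε := min (ε / 2) (1/2)) (by positivity)
  have h2 : ∀ᶠ r : ℝ in 𝓝[≥] 0, 0 ≤ r := eventually_mem_nhdsWithin
  have h3 : ∀ᶠ v : V in 𝓝 u, v ∈ interior (dualCone K) := isOpen_interior.mem_nhds hu
  have h4 := (h1.filter_mono le_rfl)
  have h5 : ∀ᶠ p : ℝ × V in (𝓝[≥] 0) ×ˢ (𝓝 u),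
      |Real.exp ⟪u, x⟫ * Lp X p.1 x u - 1| ≤ min (ε / 2) (1/2) := by
    rw [eventually_prod_iff] at h1 ⊢
    obtain ⟨pa, hpa, pb, hpb, hp⟩ := h1
    refine ⟨pa, hpa, fun _ => True, by simp, fun {r} hr {v} _ => ?_⟩
    exact (hp hr hpb.self_of_nhds).1
  filter_upwards [h1, h5, h2.prod_mk h3] with p hp1 hp5 hp2
  obtain ⟨r, v⟩ := p
  simp only at hp1 hp5 hp2 ⊢
  obtain ⟨hr, hv⟩ := hp2
  obtain ⟨ha, hb⟩ := hp1
  have hm1 := min_le_left (ε / 2) (1/2)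
  have hm2 := min_le_right (ε / 2) (1/2)
  have e1 := Lp_exp X hr (int_mem hv) hx
  have e2 := Lp_exp X hr (int_mem hu) hx
  have g1 : φ r v + ⟪ψ r v - v, x⟫ = - Real.log (Real.exp ⟪v, x⟫ * Lp X r x v) := by
    rw [e1, Real.log_exp, neg_neg]
  have g2 : φ r u + ⟪ψ r u - u, x⟫ = - Real.log (Real.exp ⟪u, x⟫ * Lp X r x u) := by
    rw [e2, Real.log_exp, neg_neg]
  rw [g1, g2]
  rw [abs_le] at ha hp5
  have := log_lip (a := Real.exp ⟪v, x⟫ * Lp X r x v) (b := Real.exp ⟪u, x⟫ * Lp X r x u)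
    (by linarith [ha.1]) (by linarith [hp5.1])
  rw [neg_sub_neg, abs_sub_comm]
  refine this.trans ?_
  rw [sub_sub_sub_cancel_right] at hb
  have hn := norm_nonneg (v - u)
  have := mul_le_mul_of_nonneg_right hm1 hn
  linarith

lemma psi_small_inner (X : AffineTransitionFamily K φ ψ) (hK : IsProperConvexCone K)
    (hu : u ∈ interior (dualCone K)) (y : V) {ε : ℝ} (hε : 0 < ε) :
    ∀ᶠ p : ℝ × V in (𝓝[≥] 0) ×ˢ (𝓝 u),
      |⟪(ψ p.1 p.2 - p.2) - (ψ p.1 u - u), y⟫| ≤ ε * ‖p.2 - u‖ := by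
  obtain ⟨a, ha, b, hb, rfl⟩ := hK.generating y
  filter_upwards [affine_small X hK hu ha (half_pos hε), affine_small X hK hu hb (half_pos hε)]
    with p h1 h2
  rw [inner_sub_right, inner_sub_left (ψ p.1 p.2 - p.2), inner_sub_left (ψ p.1 p.2 - p.2)]
  rw [abs_le] at *
  constructor <;> linarith [h1.1, h1.2, h2.1, h2.2]

lemma psi_small (X : AffineTransitionFamily K φ ψ) (hK : IsProperConvexCone K)
    (hu : u ∈ interior (dualCone K)) {ε : ℝ} (hε : 0 < ε) :
    ∀ᶠ p : ℝ × V in (𝓝[≥] 0) ×ˢ (𝓝 u),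
      ‖(ψ p.1 p.2 - p.2) - (ψ p.1 u - u)‖ ≤ ε * ‖p.2 - u‖ := by
  let o := stdOrthonormalBasis ℝ V
  set n : ℝ := ((Module.finrank ℝ V : ℕ) : ℝ) with hn
  have hn0 : 0 ≤ n := by positivity
  have h : ∀ᶠ p : ℝ × V in (𝓝[≥] 0) ×ˢ (𝓝 u), ∀ i,
      |⟪(ψ p.1 p.2 - p.2) - (ψ p.1 u - u), o i⟫| ≤ ε / (n + 1) * ‖p.2 - u‖ := by
    rw [eventually_all]
    exact fun i => psi_small_inner X hK hu _ (by positivity)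
  filter_upwards [h] with p hp
  set w := (ψ p.1 p.2 - p.2) - (ψ p.1 u - u) with hw
  calc ‖w‖ = ‖∑ i, ⟪o i, w⟫ • o i‖ := by rw [o.sum_repr' w]
    _ ≤ ∑ i, ‖⟪o i, w⟫ • o i‖ := norm_sum_le _ _
    _ = ∑ i, |⟪w, o i⟫| := by
        refine Finset.sum_congr rfl fun i _ => ?_
        rw [norm_smul, o.norm_eq_one, mul_one, Real.norm_eq_abs, real_inner_comm]
    _ ≤ ∑ i : Fin (Module.finrank ℝ V), ε / (n + 1) * ‖p.2 - u‖ :=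
        Finset.sum_le_sum fun i _ => hp i
    _ = n / (n + 1) * (ε * ‖p.2 - u‖) := by
        rw [Finset.sum_const, Finset.card_univ, Fintype.card_fin, nsmul_eq_mul, ← hn]; ring
    _ ≤ 1 * (ε * ‖p.2 - u‖) := by
        gcongr
        rw [div_le_one (by positivity)]; linarith
    _ = _ := one_mul _

lemma interior_deriv (X : AffineTransitionFamily K φ ψ) (hK : IsProperConvexCone K)
    (hu : u ∈ interior (dualCone K)) :
    ∃ f : ℝ, ∃ r : V, HasDerivWithinAt (fun t => φ t u) f (Ici 0) 0 ∧
      HasDerivWithinAt (fun t => ψ t u) r (Ici 0) 0 := by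
  have huK := int_mem hu
  have hcont : ContinuousOn (fun t => ((φ t u, ψ t u) : ℝ × V)) (Ici 0) :=
    (phi_cont_t X hK huK).prodMk (psi_cont_t X hK huK)
  obtain ⟨d, hd⟩ := curve_deriv hcont (by
    intro ε hε
    have h1 := affine_small X hK hu (zero_mem hK) hε
    have h2 := psi_small X hK hu hε
    have h3 : Tendsto (fun t => ψ t u) (𝓝[≥] 0) (𝓝 u) := by
      have := psi_cont_t X hK huK 0 (by simp)
      rw [ContinuousWithinAt, (flow0 X hK huK).2] at this
      exact this
    have h4 : Tendsto (fun p : ℝ × ℝ => (p.1, ψ p.2 u)) ((𝓝[≥] 0) ×ˢ (𝓝[≥] 0))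
        ((𝓝[≥] 0) ×ˢ (𝓝 u)) := tendsto_id.prodMap h3
    have h5 := h4.eventually (h1.and h2)
    rw [((nhdsGE_basis (0:ℝ)).prod_self).eventually_iff] at h5
    obtain ⟨δ, hδ, h5⟩ := h5
    refine ⟨δ / 2, by positivity, fun r t hr0 hr ht0 ht => ?_⟩
    have h6 := h5 (x := (r, t)) ⟨⟨hr0, by simp only; linarith⟩, ⟨ht0, by simp only; linarith⟩⟩
    simp only [inner_zero_right, add_zero] at h6
    have f1 := flow X hK hr0 ht0 huK
    have f0 := flow0 X hK huK
    simp only [Prod.mk_sub_mk, f1.1, f1.2, f0.1, f0.2, sub_zero]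
    have hle : ‖ψ t u - u‖ ≤ ‖((φ t u, ψ t u - u) : ℝ × V)‖ := by
      rw [Prod.norm_def]; exact le_max_right _ _
    rw [Prod.norm_def, max_le_iff]
    constructor
    · simp only [Real.norm_eq_abs]
      rw [show φ t u + φ r (ψ t u) - φ t u - φ r u = φ r (ψ t u) - φ r u by ring]
      exact h6.1.trans (by gcongr)
    · simp only
      rw [show ψ r (ψ t u) - u - (ψ t u - u) - (ψ r u - u)
        = ψ r (ψ t u) - ψ t u - (ψ r u - u) by abel]
      exact h6.2.trans (by gcongr))
  refine ⟨d.1, d.2, ?_, ?_⟩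
  · exact (ContinuousLinearMap.fst ℝ ℝ V).hasFDerivAt.comp_hasDerivWithinAt (0:ℝ) hd
  · exact (ContinuousLinearMap.snd ℝ ℝ V).hasFDerivAt.comp_hasDerivWithinAt (0:ℝ) hd

end interior_deriv

section extension

variable {x u e : V}

lemma At_tendsto (X : AffineTransitionFamily K φ ψ) (hK : IsProperConvexCone K)
    (hu : u ∈ dualCone K) (hx : x ∈ K) {f : ℝ} {r : V}
    (hf : HasDerivWithinAt (fun t => φ t u) f (Ici 0) 0)
    (hr : HasDerivWithinAt (fun t => ψ t u) r (Ici 0) 0) :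
    Tendsto (fun t => (1 - Real.exp ⟪u, x⟫ * Lp X t x u) / t) (𝓝[>] 0) (𝓝 (f + ⟪r, x⟫)) := by
  have h1 : HasDerivWithinAt (fun t => ⟪ψ t u - u, x⟫) ⟪r, x⟫ (Ici 0) 0 := by
    have := (hr.sub_const u).inner ℝ (hasDerivWithinAt_const (0:ℝ) (Ici 0) x)
    simpa using this
  have h2 := ((hf.add h1).neg.exp).neg.add_const 1
  have f0 := flow0 X hK hu
  rw [← hasDerivWithinAt_Ioi_iff_Ici, hasDerivWithinAt_iff_tendsto_slope' (by simp)] at h2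
  simp only [f0.1, f0.2, Pi.neg_apply, Pi.add_apply, sub_self, inner_zero_left, add_zero, neg_zero,
    Real.exp_zero, one_mul, neg_neg] at h2
  refine h2.congr' ?_
  filter_upwards [self_mem_nhdsWithin] with t ht
  have ht0 : (0:ℝ) < t := ht
  rw [Lp_exp X ht0.le hu hx, slope_def_field]
  simp [f0.1, f0.2]
  ring

lemma A_concave (X : AffineTransitionFamily K φ ψ) {A : V → ℝ} (hx : x ∈ K)
    (hA : ∀ u ∈ interior (dualCone K),
      Tendsto (fun t => (1 - Real.exp ⟪u, x⟫ * Lp X t x u) / t) (𝓝[>] 0) (𝓝 (A u))) :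
    ConcaveOn ℝ (interior (dualCone K)) A := by
  refine ⟨int_convex, fun u hu v hv a b ha hb hab => ?_⟩
  have h1 := ((hA u hu).const_mul a).add ((hA v hv).const_mul b)
  have h2 := hA _ (int_convex hu hv ha hb hab)
  refine le_of_tendsto_of_tendsto h1 h2 ?_
  filter_upwards [self_mem_nhdsWithin] with t ht
  have ht0 : (0:ℝ) < t := ht
  have h3 := (Lp_convex X ht0.le hx).2 (int_mem hu) (int_mem hv) ha hb hab
  simp only [smul_eq_mul] at h3
  rw [← mul_div_assoc, ← mul_div_assoc, ← add_div]
  gcongr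
  nlinarith

/-- second difference of the Laplace transform -/
noncomputable def J (X : AffineTransitionFamily K φ ψ) (e x : V) (t : ℝ) (u : V) : ℝ :=
  ∫ ξ, Real.exp (-⟪u, ξ⟫) * (1 - Real.exp (-⟪e, ξ - x⟫))^2 ∂(X.p t x)

lemma J_point (e x u ξ : V) : Real.exp (-⟪u, ξ⟫) * (1 - Real.exp (-⟪e, ξ - x⟫))^2 =
    Real.exp (-⟪u, ξ⟫) - 2 * Real.exp ⟪e, x⟫ * Real.exp (-⟪u + e, ξ⟫)
      + Real.exp ⟪e, x⟫ ^ 2 * Real.exp (-⟪u + e + e, ξ⟫) := by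
  have h1 : Real.exp (-⟪e, ξ - x⟫) = Real.exp ⟪e, x⟫ * Real.exp (-⟪e, ξ⟫) := by
    rw [← Real.exp_add, inner_sub_right]; congr 1; ring
  have h2 : Real.exp (-⟪u + e, ξ⟫) = Real.exp (-⟪u, ξ⟫) * Real.exp (-⟪e, ξ⟫) := by
    rw [← Real.exp_add, inner_add_left]; congr 1; ring
  have h3 : Real.exp (-⟪u + e + e, ξ⟫)
      = Real.exp (-⟪u, ξ⟫) * Real.exp (-⟪e, ξ⟫) * Real.exp (-⟪e, ξ⟫) := by
    rw [← h2, ← Real.exp_add, inner_add_left]; congr 1; ring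
  rw [h1, h2, h3]; ring

lemma J_integ (X : AffineTransitionFamily K φ ψ) {t : ℝ} (ht : 0 ≤ t) (hx : x ∈ K)
    (he : e ∈ dualCone K) (hu : u ∈ dualCone K) :
    Integrable (fun ξ => Real.exp (-⟪u, ξ⟫) * (1 - Real.exp (-⟪e, ξ - x⟫))^2) (X.p t x) := by
  simp_rw [J_point]
  have h0 := integ X ht hu hx
  have h1 := integ X ht (dual_add hu he) hx
  have h2 := integ X ht (dual_add (dual_add hu he) he) hx
  exact (h0.sub (h1.const_mul _)).add (h2.const_mul _)

lemma J_eq (X : AffineTransitionFamily K φ ψ) {t : ℝ} (ht : 0 ≤ t) (hx : x ∈ K)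
    (he : e ∈ dualCone K) (hu : u ∈ dualCone K) :
    J X e x t u = Lp X t x u - 2 * Real.exp ⟪e, x⟫ * Lp X t x (u + e)
      + Real.exp ⟪e, x⟫ ^ 2 * Lp X t x (u + e + e) := by
  rw [J]
  simp_rw [J_point]
  have h0 := integ X ht hu hx
  have h1 := integ X ht (dual_add hu he) hx
  have h2 := integ X ht (dual_add (dual_add hu he) he) hx
  have h3 : Integrable (fun ξ => Real.exp (-⟪u, ξ⟫)
    - 2 * Real.exp ⟪e, x⟫ * Real.exp (-⟪u + e, ξ⟫)) (X.p t x) := h0.sub (h1.const_mul _)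
  rw [integral_add h3 (h2.const_mul _), integral_sub h0 (h1.const_mul _), integral_const_mul,
    integral_const_mul]
  rfl

lemma J_anti (X : AffineTransitionFamily K φ ψ) {t : ℝ} (ht : 0 ≤ t) (hx : x ∈ K)
    (he : e ∈ dualCone K) {v : V} (hu : u ∈ dualCone K) (hv : v ∈ dualCone K)
    (huv : v - u ∈ dualCone K) : J X e x t v ≤ J X e x t u := by
  refine integral_mono_ae (J_integ X ht hx he hv) (J_integ X ht hx he hu) ?_
  filter_upwards [aeK X ht hx] with ξ hξ
  have := dual_inner huv hξ
  rw [inner_sub_left] at this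
  exact mul_le_mul_of_nonneg_right (Real.exp_le_exp.2 (by linarith)) (sq_nonneg _)

lemma J_diff (X : AffineTransitionFamily K φ ψ) {t : ℝ} (ht : 0 ≤ t) (hx : x ∈ K)
    (he : e ∈ dualCone K) {v w d : V} (hu : u ∈ dualCone K) (hv : v ∈ dualCone K)
    (hw : w ∈ dualCone K) (hd : d ∈ dualCone K) (huw : u - w ∈ dualCone K)
    (huv : u + d - v ∈ dualCone K) :
    J X e x t u - J X e x t v ≤ J X e x t w - J X e x t (w + d) := by
  have i1 := J_integ X ht hx he hu
  have i2 := J_integ X ht hx he hv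
  have i3 := J_integ X ht hx he hw
  have i4 := J_integ X ht hx he (dual_add hw hd)
  rw [J, J, J, J, ← integral_sub i1 i2, ← integral_sub i3 i4]
  refine integral_mono_ae (i1.sub i2) (i3.sub i4) ?_
  filter_upwards [aeK X ht hx] with ξ hξ
  have h1 := dual_inner huw hξ
  have h2 := dual_inner huv hξ
  have h3 := dual_inner hd hξ
  rw [inner_sub_left] at h1 h2
  rw [inner_add_left] at h2
  rw [← sub_mul, ← sub_mul]
  refine mul_le_mul_of_nonneg_right ?_ (sq_nonneg _)
  have e1 : Real.exp (-⟪u, ξ⟫) * Real.exp (-⟪d, ξ⟫) ≤ Real.exp (-⟪v, ξ⟫) := by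
    rw [← Real.exp_add]; exact Real.exp_le_exp.2 (by linarith)
  have e2 : Real.exp (-⟪w + d, ξ⟫) = Real.exp (-⟪w, ξ⟫) * Real.exp (-⟪d, ξ⟫) := by
    rw [← Real.exp_add, inner_add_left]; congr 1; ring
  have e3 : Real.exp (-⟪u, ξ⟫) ≤ Real.exp (-⟪w, ξ⟫) := Real.exp_le_exp.2 (by linarith)
  have e4 : Real.exp (-⟪d, ξ⟫) ≤ 1 := Real.exp_le_one_iff.2 (by linarith)
  rw [e2]
  nlinarith

/-- abstract uniform continuity -/
lemma unif_abstract (heK : e ∈ dualCone K) (he : ∀ x ∈ K, ‖x‖ ≤ ⟪e, x⟫) {N : V → ℝ} {B : ℝ}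
    (hanti : ∀ u ∈ interior (dualCone K), ∀ v ∈ interior (dualCone K), v - u ∈ dualCone K →
      N v ≤ N u)
    (hbd : ∀ u ∈ interior (dualCone K), N u ≤ B)
    (hdiff : ∀ u ∈ interior (dualCone K), ∀ v ∈ interior (dualCone K),
      ∀ w ∈ interior (dualCone K), ∀ d ∈ dualCone K, w + d ∈ interior (dualCone K) →
      u - w ∈ dualCone K → u + d - v ∈ dualCone K → N u - N v ≤ N w - N (w + d))
    {ε : ℝ} (hε : 0 < ε) :
    ∃ δ > 0, ∀ u ∈ interior (dualCone K), ∀ v ∈ interior (dualCone K), ‖u - v‖ ≤ δ →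
      |N u - N v| < ε := by
  set S : Set ℝ := (fun s : ℝ => N (s • e)) '' Ioi 0 with hS
  have hSne : S.Nonempty := ⟨_, 1, by simp, rfl⟩
  have hSb : BddAbove S := ⟨B, by rintro _ ⟨s, hs, rfl⟩; exact hbd _ (e_int he hs)⟩
  obtain ⟨_, ⟨s, hs, rfl⟩, hlt⟩ := exists_lt_of_lt_csSup hSne (show sSup S - ε < sSup S by linarith)
  have hs0 : (0:ℝ) < s := hs
  have key : ∀ u ∈ interior (dualCone K), ∀ v ∈ interior (dualCone K), ‖u - v‖ ≤ s / 2 →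
      N u - N v < ε := by
    intro u hu v hv huv
    obtain ⟨η, hη, hη2⟩ := int_sub e hu
    set κ := min η (s / 2) with hκ
    have hκ0 : 0 < κ := by positivity
    have hκs : κ ≤ s / 2 := min_le_right _ _
    have h1 := hdiff u hu v hv (κ • e) (e_int he hκ0) ((s / 2) • e)
      (dual_smul (by positivity) heK)
      (by rw [← add_smul]; exact e_int he (by positivity))
      (hη2 κ (min_le_left _ _) hκ0.le)
      (by have := le_of_norm he huv
          convert this using 1; abel)
    have h2 : N (κ • e) ≤ sSup S := le_csSup hSb ⟨κ, hκ0, rfl⟩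
    have h3 : N (s • e) ≤ N (κ • e + (s / 2) • e) := by
      rw [← add_smul]
      refine hanti _ (e_int he (by positivity)) _ (e_int he hs0) ?_
      rw [← sub_smul]
      exact dual_smul (by linarith) heK
    linarith
  refine ⟨s / 2, by positivity, fun u hu v hv huv => ?_⟩
  have h1 := key u hu v hv huv
  have h2 := key v hv u hu (by rwa [norm_sub_rev])
  rw [abs_lt]; constructor <;> linarith

lemma N_tendsto (X : AffineTransitionFamily K φ ψ) {A : V → ℝ} (hx : x ∈ K)
    (heK : e ∈ dualCone K) (he : ∀ x ∈ K, ‖x‖ ≤ ⟪e, x⟫)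
    (hA : ∀ u ∈ interior (dualCone K),
      Tendsto (fun t => (1 - Real.exp ⟪u, x⟫ * Lp X t x u) / t) (𝓝[>] 0) (𝓝 (A u)))
    (hu : u ∈ interior (dualCone K)) :
    Tendsto (fun t => J X e x t u / t) (𝓝[>] 0)
      (𝓝 (Real.exp (-⟪u, x⟫) * (-A u + 2 * A (u + e) - A (u + e + e)))) := by
  have hue : u + e ∈ interior (dualCone K) := by simpa using mem_int he (int_mem hu) one_pos
  have huee : u + e + e ∈ interior (dualCone K) := by
    simpa using mem_int he (int_mem hue) one_pos
  have h := (((hA u hu).neg.add ((hA _ hue).const_mul 2)).sub (hA _ huee)).const_mul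
    (Real.exp (-⟪u, x⟫))
  refine h.congr' ?_
  filter_upwards [self_mem_nhdsWithin] with t ht
  have ht0 : (0:ℝ) < t := ht
  rw [J_eq X ht0.le hx heK (int_mem hu)]
  have e1 : Real.exp ⟪u + e, x⟫ = Real.exp ⟪u, x⟫ * Real.exp ⟪e, x⟫ := by
    rw [← Real.exp_add, inner_add_left]
  have e2 : Real.exp ⟪u + e + e, x⟫ = Real.exp ⟪u, x⟫ * Real.exp ⟪e, x⟫ * Real.exp ⟪e, x⟫ := by
    rw [← e1, ← Real.exp_add, inner_add_left]
  have e3 : Real.exp (-⟪u, x⟫) = (Real.exp ⟪u, x⟫)⁻¹ := Real.exp_neg _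
  have e4 := (Real.exp_pos ⟪u, x⟫).ne'
  rw [e1, e2, e3]
  field_simp
  ring

lemma A_extends (X : AffineTransitionFamily K φ ψ) (hK : IsProperConvexCone K) {A : V → ℝ}
    (hx : x ∈ K)
    (hA : ∀ u ∈ interior (dualCone K),
      Tendsto (fun t => (1 - Real.exp ⟪u, x⟫ * Lp X t x u) / t) (𝓝[>] 0) (𝓝 (A u)))
    (hu : u ∈ dualCone K) : ∃ c, Tendsto A (𝓝[interior (dualCone K)] u) (𝓝 c) := by
  obtain ⟨e, heK, he⟩ := exists_e hK
  have hei : e ∈ interior (dualCone K) := by simpa using e_int he one_pos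
  have heei : e + e ∈ interior (dualCone K) := by simpa using mem_int he heK one_pos
  set N : V → ℝ := fun u => Real.exp (-⟪u, x⟫) * (-A u + 2 * A (u + e) - A (u + e + e)) with hN
  have hNt : ∀ u ∈ interior (dualCone K), Tendsto (fun t => J X e x t u / t) (𝓝[>] 0) (𝓝 (N u)) :=
    fun u hu => N_tendsto X hx heK he hA hu
  have hAc : ContinuousOn A (interior (dualCone K)) := (A_concave X hx hA).continuousOn
    isOpen_interior
  have hunif := fun ε (hε : 0 < ε) => unif_abstract (K := K) (N := N) (B := 2 * A e - A (e + e))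
    heK he
    (by
      intro u hu v hv huv
      refine le_of_tendsto_of_tendsto (hNt v hv) (hNt u hu) ?_
      filter_upwards [self_mem_nhdsWithin] with t ht
      have ht0 : (0:ℝ) < t := ht
      gcongr
      exact J_anti X ht0.le hx heK (int_mem hu) (int_mem hv) huv)
    (by
      intro u hu
      refine le_of_tendsto_of_tendsto (hNt u hu) (((hA e hei).const_mul 2).sub (hA _ heei)) ?_
      filter_upwards [self_mem_nhdsWithin] with t ht
      have ht0 : (0:ℝ) < t := ht
      have h1 := J_anti X ht0.le hx heK dual_zero (int_mem hu) (by simpa using int_mem hu)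
      have h2 := J_eq X ht0.le hx heK (dual_zero (K := K))
      have h3 := Lp_le_one X ht0.le hx (dual_zero (K := K))
      rw [zero_add] at h2
      have e2 : Real.exp ⟪e + e, x⟫ = Real.exp ⟪e, x⟫ ^ 2 := by
        rw [sq, ← Real.exp_add, inner_add_left]
      rw [e2, ← mul_div_assoc, ← sub_div]
      gcongr
      nlinarith)
    (by
      intro u hu v hv w hw d hd hwd huw huv
      refine le_of_tendsto_of_tendsto ((hNt u hu).sub (hNt v hv)) ((hNt w hw).sub (hNt _ hwd)) ?_
      filter_upwards [self_mem_nhdsWithin] with t ht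
      have ht0 : (0:ℝ) < t := ht
      rw [← sub_div, ← sub_div]
      gcongr ?_ / t
      exact J_diff X ht0.le hx heK (int_mem hu) (int_mem hv) (int_mem hw) hd huw huv) hε
  have hne : (𝓝[interior (dualCone K)] u).NeBot := by
    rw [← mem_closure_iff_nhdsWithin_neBot]
    have : Tendsto (fun s : ℝ => u + s • e) (𝓝[>] 0) (𝓝 u) := by
      have h : Continuous (fun s : ℝ => u + s • e) := by fun_prop
      have := h.tendsto 0
      simp only [zero_smul, add_zero] at this
      exact this.mono_left nhdsWithin_le_nhds
    refine mem_closure_of_tendsto this ?_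
    filter_upwards [self_mem_nhdsWithin] with s hs
    exact mem_int he hu hs
  have hcau : Cauchy (map N (𝓝[interior (dualCone K)] u)) := by
    rw [Metric.cauchy_iff]
    refine ⟨inferInstance, fun ε hε => ?_⟩
    obtain ⟨δ, hδ, h⟩ := hunif ε hε
    refine ⟨N '' (Metric.ball u (δ / 2) ∩ interior (dualCone K)), image_mem_map
      (inter_mem (mem_nhdsWithin_of_mem_nhds (Metric.ball_mem_nhds _ (by positivity)))
        self_mem_nhdsWithin), ?_⟩
    rintro _ ⟨a, ⟨ha, ha'⟩, rfl⟩ _ ⟨b, ⟨hb, hb'⟩, rfl⟩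
    rw [Real.dist_eq]
    refine h a ha' b hb' ?_
    rw [← dist_eq_norm]
    rw [Metric.mem_ball] at ha hb
    linarith [dist_triangle_right a b u]
  obtain ⟨c, hc⟩ := cauchy_map_iff_exists_tendsto.1 hcau
  have hshift : ∀ d ∈ interior (dualCone K), u + d ∈ interior (dualCone K) →
      Tendsto (fun v => A (v + d)) (𝓝[interior (dualCone K)] u) (𝓝 (A (u + d))) := by
    intro d hd hud
    have h1 : ContinuousAt A (u + d) := hAc.continuousAt (isOpen_interior.mem_nhds hud)
    have h2 : Tendsto (fun v : V => v + d) (𝓝 u) (𝓝 (u + d)) :=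
      (continuous_id.add continuous_const).tendsto u
    exact (h1.tendsto.comp h2).mono_left nhdsWithin_le_nhds
  have hue : u + e ∈ interior (dualCone K) := by simpa using mem_int he hu one_pos
  have huee : u + (e + e) ∈ interior (dualCone K) := by
    rw [← add_assoc]
    simpa using mem_int he (int_mem hue) one_pos
  have hexp : Tendsto (fun v : V => Real.exp ⟪v, x⟫) (𝓝[interior (dualCone K)] u)
      (𝓝 (Real.exp ⟪u, x⟫)) := by
    have h : Continuous (fun v : V => Real.exp ⟪v, x⟫) := by fun_prop
    exact (h.tendsto u).mono_left nhdsWithin_le_nhds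
  refine ⟨_, ((((hexp.mul hc).neg).add ((hshift e hei hue).const_mul 2)).sub
    (hshift (e + e) heei huee)).congr fun v => ?_⟩
  simp only [hN]
  rw [← mul_assoc, ← Real.exp_add, ← add_assoc]
  simp
  ring

end extension

section final

variable {u x : V}

lemma generic {E : Type*} [NormedAddCommGroup E] [NormedSpace ℝ E] [CompleteSpace E]
    (X : AffineTransitionFamily K φ ψ) (hK : IsProperConvexCone K)
    (c : ℝ → V → E) (G : V → E) (hG : ContinuousOn G (dualCone K))
    (hct : ∀ u ∈ dualCone K, ContinuousOn (fun t => c t u) (Ici 0))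
    (hcu : ∀ t, 0 ≤ t → ContinuousOn (fun u => c t u) (dualCone K))
    (hd : ∀ u ∈ interior (dualCone K), ∀ s, 0 ≤ s →
      HasDerivWithinAt (fun t => c t u) (G (ψ s u)) (Ici s) s)
    (hu : u ∈ dualCone K) {t : ℝ} (ht : 0 ≤ t) :
    HasDerivWithinAt (fun t => c t u) (G (ψ t u)) (Ici 0) t := by
  obtain ⟨e, heK, he⟩ := exists_e hK
  obtain ⟨z, hzK, hz⟩ := exists_z hK
  have hGc : ∀ u ∈ dualCone K, ContinuousOn (fun s => G (ψ s u)) (Ici 0) := fun u hu =>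
    hG.comp (psi_cont_t X hK hu) fun s hs => psi_mem X hK hs hu
  have hint0 : ∀ v ∈ interior (dualCone K), ∀ t, 0 ≤ t →
      ∫ s in (0:ℝ)..t, G (ψ s v) = c t v - c 0 v := by
    intro v hv t ht
    refine intervalIntegral.integral_eq_sub_of_hasDeriv_right_of_le ht
      ((hct v (int_mem hv)).mono Icc_subset_Ici_self) (fun s hs => ?_) ?_
    · exact (hd v hv s hs.1.le).mono Ioi_subset_Ici_self
    · refine ContinuousOn.intervalIntegrable ?_
      rw [uIcc_of_le ht]
      exact (hGc v (int_mem hv)).mono Icc_subset_Ici_self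
  have hmain : ∀ t, 0 ≤ t → c t u = c 0 u + ∫ s in (0:ℝ)..t, G (ψ s u) := by
    intro t ht
    set w : ℕ → V := fun n => u + (1 / ((n:ℝ) + 1)) • e with hw
    have hpos : ∀ n : ℕ, (0:ℝ) < 1 / ((n:ℝ) + 1) := fun n => by positivity
    have hwi : ∀ n, w n ∈ interior (dualCone K) := fun n => mem_int he hu (hpos n)
    have hwt : Tendsto w atTop (𝓝[dualCone K] u) := by
      refine tendsto_nhdsWithin_iff.2 ⟨?_, Eventually.of_forall fun n => int_mem (hwi n)⟩
      have := (tendsto_one_div_add_atTop_nhds_zero_nat (𝕜 := ℝ)).smul_const e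
      simpa [hw] using this.const_add u
    have hue : u + e ∈ dualCone K := dual_add hu heK
    have hwle : ∀ n, (u + e) - w n ∈ dualCone K := by
      intro n
      have : (u + e) - w n = (1 - 1 / ((n:ℝ) + 1)) • e := by
        simp only [hw, sub_smul, one_smul]; abel
      rw [this]
      refine dual_smul ?_ heK
      rw [sub_nonneg, div_le_one (by positivity)]
      linarith [(Nat.cast_nonneg n : (0:ℝ) ≤ n)]
    obtain ⟨M, hM⟩ : ∃ M, ∀ s ∈ Icc 0 t, ‖ψ s (u + e)‖ ≤ M :=
      isCompact_Icc.exists_bound_of_continuousOn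
        ((psi_cont_t X hK hue).mono Icc_subset_Ici_self)
    have hb : ∀ n, ∀ s ∈ Icc 0 t, ‖ψ s (w n)‖ ≤ ‖z‖ * M := by
      intro n s hs
      have h1 := hz _ (psi_mem X hK hs.1 (int_mem (hwi n)))
      have h2 := dual_inner (psi_mono X hK hs.1 (int_mem (hwi n)) hue (hwle n)) hzK
      rw [inner_sub_left, real_inner_comm, real_inner_comm z] at h2
      have h3 := real_inner_le_norm z (ψ s (u + e))
      have h4 := mul_le_mul_of_nonneg_left (hM s hs) (norm_nonneg z)
      linarith
    obtain ⟨B, hB⟩ : ∃ B, ∀ v ∈ dualCone K ∩ Metric.closedBall 0 (‖z‖ * M), ‖G v‖ ≤ B :=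
      ((isCompact_closedBall (0:V) (‖z‖ * M)).inter_left
        dual_closed).exists_bound_of_continuousOn (hG.mono inter_subset_left)
    have hlim : Tendsto (fun n => ∫ s in (0:ℝ)..t, G (ψ s (w n))) atTop
        (𝓝 (∫ s in (0:ℝ)..t, G (ψ s u))) := by
      refine intervalIntegral.tendsto_integral_filter_of_dominated_convergence (fun _ => B)
        ?_ ?_ ?_ ?_
      · refine Eventually.of_forall fun n => ?_
        rw [uIoc_of_le ht]
        exact ((hGc _ (int_mem (hwi n))).mono fun s hs => hs.1.le).aestronglyMeasurable
          measurableSet_Ioc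
      · refine Eventually.of_forall fun n => Eventually.of_forall fun s hs => ?_
        rw [uIoc_of_le ht] at hs
        refine hB _ ⟨psi_mem X hK hs.1.le (int_mem (hwi n)), ?_⟩
        rw [mem_closedBall_zero_iff]
        exact hb n s ⟨hs.1.le, hs.2⟩
      · exact intervalIntegrable_const
      · refine Eventually.of_forall fun s hs => ?_
        rw [uIoc_of_le ht] at hs
        have hc1 : ContinuousOn (fun v => G (ψ s v)) (dualCone K) :=
          hG.comp (psi_cont_u X hK hs.1.le) fun v hv => psi_mem X hK hs.1.le hv
        exact (hc1 u hu).tendsto.comp hwt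
    have hlim2 : Tendsto (fun n => ∫ s in (0:ℝ)..t, G (ψ s (w n))) atTop
        (𝓝 (c t u - c 0 u)) := by
      simp only [hint0 _ (hwi _) t ht]
      exact ((hcu t ht u hu).tendsto.comp hwt).sub ((hcu 0 le_rfl u hu).tendsto.comp hwt)
    rw [tendsto_nhds_unique hlim hlim2]
    abel
  have hcont : Continuous (fun s => G (ψ (max s 0) u)) := by
    have h := hGc u hu
    exact h.comp_continuous (f := fun s : ℝ => max s 0) (by fun_prop)
      fun s => mem_Ici.2 (le_max_right _ _)
  have hD : HasDerivAt (fun t => c 0 u + ∫ s in (0:ℝ)..t, G (ψ (max s 0) u)) (G (ψ (max t 0) u)) t :=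
    (intervalIntegral.integral_hasDerivAt_right (hcont.intervalIntegrable _ _)
      (hcont.stronglyMeasurableAtFilter _ _) hcont.continuousAt).const_add _
  rw [max_eq_left ht] at hD
  have heq : ∀ t ∈ Ici (0:ℝ), c t u = c 0 u + ∫ s in (0:ℝ)..t, G (ψ (max s 0) u) := by
    intro t ht
    rw [hmain t ht]
    congr 1
    refine intervalIntegral.integral_congr fun s hs => ?_
    rw [uIcc_of_le ht] at hs
    simp only [max_eq_left hs.1]
  exact hD.hasDerivWithinAt.congr heq (heq t ht)

lemma shift_deriv {E : Type*} [NormedAddCommGroup E] [NormedSpace ℝ E] {f g : ℝ → E} {f' : E}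
    {s : ℝ} {k : E} (h : ∀ t, 0 ≤ t → f (s + t) = k + g t)
    (hg : HasDerivWithinAt g f' (Ici 0) 0) : HasDerivWithinAt f f' (Ici s) s := by
  have h1 : HasDerivWithinAt (fun r => r - s) 1 (Ici s) s := (hasDerivWithinAt_id s _).sub_const s
  have hg' : HasDerivWithinAt g f' (Ici 0) (s - s) := by simpa using hg
  have h2 := (HasDerivWithinAt.scomp (h := fun r => r - s) s hg' h1 (fun r hr => by simpa using hr)).const_add k
  rw [one_smul] at h2
  refine h2.congr (fun r hr => ?_) ?_
  · have := h (r - s) (by simpa using hr)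
    simpa using this
  · have := h 0 le_rfl
    simpa using this

lemma exists_FR (X : AffineTransitionFamily K φ ψ) (hK : IsProperConvexCone K) :
    ∃ F : V → ℝ, ∃ R : V → V, ContinuousOn F (dualCone K) ∧ ContinuousOn R (dualCone K) ∧
      ∀ u ∈ interior (dualCone K), HasDerivWithinAt (fun t => φ t u) (F u) (Ici 0) 0 ∧
        HasDerivWithinAt (fun t => ψ t u) (R u) (Ici 0) 0 := by
  choose! F0 R0 h0 using fun u (hu : u ∈ interior (dualCone K)) => interior_deriv X hK hu
  obtain ⟨e, heK, he⟩ := exists_e hK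
  have hcl : dualCone K ⊆ closure (interior (dualCone K)) := by
    intro u hu
    have : Tendsto (fun s : ℝ => u + s • e) (𝓝[>] 0) (𝓝 u) := by
      have h : Continuous (fun s : ℝ => u + s • e) := by fun_prop
      have := h.tendsto 0
      simp only [zero_smul, add_zero] at this
      exact this.mono_left nhdsWithin_le_nhds
    refine mem_closure_of_tendsto this ?_
    filter_upwards [self_mem_nhdsWithin] with s hs
    exact mem_int he hu hs
  have hA : ∀ x ∈ K, ∀ u ∈ dualCone K,
      ∃ c, Tendsto (fun u => F0 u + ⟪R0 u, x⟫) (𝓝[interior (dualCone K)] u) (𝓝 c) :=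
    fun x hx u hu => A_extends X hK hx
      (fun u hu => At_tendsto X hK (int_mem hu) hx (h0 u hu).1 (h0 u hu).2) hu
  have hF : ∀ u ∈ dualCone K, ∃ c, Tendsto F0 (𝓝[interior (dualCone K)] u) (𝓝 c) := by
    intro u hu
    obtain ⟨c, hc⟩ := hA 0 (zero_mem hK) u hu
    exact ⟨c, by simpa using hc⟩
  have hR : ∀ u ∈ dualCone K, ∃ c, Tendsto R0 (𝓝[interior (dualCone K)] u) (𝓝 c) := by
    intro u hu
    refine exists_tendsto_of_inner hK fun x hx => ?_
    obtain ⟨c, hc⟩ := hF u hu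
    obtain ⟨d, hd⟩ := hA x hx u hu
    exact ⟨d - c, by simpa using hd.sub hc⟩
  refine ⟨extendFrom (interior (dualCone K)) F0, extendFrom (interior (dualCone K)) R0,
    continuousOn_extendFrom hcl hF, continuousOn_extendFrom hcl hR, fun u hu => ?_⟩
  have key : ∀ {E : Type _} [NormedAddCommGroup E] (f : V → E),
      (∃ c, Tendsto f (𝓝[interior (dualCone K)] u) (𝓝 c)) →
      extendFrom (interior (dualCone K)) f u = f u := by
    rintro E _ f ⟨c, hc⟩
    have h1 := extendFrom_eq (hcl (int_mem hu)) hc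
    rw [h1]
    have h2 : Tendsto f (pure u) (𝓝 c) := hc.mono_left (pure_le_nhdsWithin hu)
    exact tendsto_nhds_unique h2 (tendsto_pure_nhds f u)
  rw [key F0 (hF u (int_mem hu))]
  have key2 : extendFrom (interior (dualCone K)) R0 u = R0 u := by
    obtain ⟨c, hc⟩ := hR u (int_mem hu)
    have h1 := extendFrom_eq (hcl (int_mem hu)) hc
    rw [h1]
    have h2 : Tendsto R0 (pure u) (𝓝 c) := hc.mono_left (pure_le_nhdsWithin hu)
    exact tendsto_nhds_unique h2 (tendsto_pure_nhds R0 u)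
  rw [key2]
  exact h0 u hu

end final

end AffReg

/-- An affine family of transition kernels on `K` is regular: the
derivatives `F(u) = ∂ₜφ(t,u)|ₜ₌₀` and `R(u) = ∂ₜψ(t,u)|ₜ₌₀` exist for every
`u ∈ K*` and are continuous on `K*`; moreover `φ` and `ψ` are differentiable in
time on `ℝ₊` and satisfy the generalized Riccati equations
`∂ₜφ(t,u) = F(ψ(t,u))`, `φ(0,u) = 0`, and `∂ₜψ(t,u) = R(ψ(t,u))`, `ψ(0,u) = u`. -/
theorem affine_regular
    {V : Type*} [NormedAddCommGroup V] [InnerProductSpace ℝ V] [FiniteDimensional ℝ V]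
    [MeasurableSpace V] [BorelSpace V]
    (K : Set V) (hK : IsProperConvexCone K)
    (φ : ℝ → V → ℝ) (ψ : ℝ → V → V)
    (X : AffineTransitionFamily K φ ψ) :
    ∃ F : V → ℝ, ∃ R : V → V,
      ContinuousOn F (dualCone K) ∧ ContinuousOn R (dualCone K) ∧
      ∀ u ∈ dualCone K,
        HasDerivWithinAt (fun t => φ t u) (F u) (Set.Ici (0 : ℝ)) 0 ∧
        HasDerivWithinAt (fun t => ψ t u) (R u) (Set.Ici (0 : ℝ)) 0 ∧
        φ 0 u = 0 ∧ ψ 0 u = u ∧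
        ∀ t : ℝ, 0 ≤ t →
          HasDerivWithinAt (fun s => φ s u) (F (ψ t u)) (Set.Ici (0 : ℝ)) t ∧
          HasDerivWithinAt (fun s => ψ s u) (R (ψ t u)) (Set.Ici (0 : ℝ)) t := by
  obtain ⟨F, R, hF, hR, h⟩ := AffReg.exists_FR X hK
  have hφ : ∀ u ∈ dualCone K, ∀ t : ℝ, 0 ≤ t →
      HasDerivWithinAt (fun s => φ s u) (F (ψ t u)) (Set.Ici (0 : ℝ)) t := by
    intro u hu t ht
    refine AffReg.generic X hK φ F hF (fun u hu => AffReg.phi_cont_t X hK hu)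
      (fun t ht => AffReg.phi_cont_u X hK ht) (fun v hv s hs => ?_) hu ht
    exact AffReg.shift_deriv (g := fun t => φ t (ψ s v)) (k := φ s v)
      (fun r hr => (AffReg.flow X hK hr hs (AffReg.int_mem hv)).1)
      (h _ (AffReg.psi_int X hK hs hv)).1
  have hψ : ∀ u ∈ dualCone K, ∀ t : ℝ, 0 ≤ t →
      HasDerivWithinAt (fun s => ψ s u) (R (ψ t u)) (Set.Ici (0 : ℝ)) t := by
    intro u hu t ht
    refine AffReg.generic X hK ψ R hR (fun u hu => AffReg.psi_cont_t X hK hu)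
      (fun t ht => AffReg.psi_cont_u X hK ht) (fun v hv s hs => ?_) hu ht
    exact AffReg.shift_deriv (g := fun t => ψ t (ψ s v)) (k := 0)
      (fun r hr => by rw [zero_add]; exact (AffReg.flow X hK hr hs (AffReg.int_mem hv)).2)
      (h _ (AffReg.psi_int X hK hs hv)).2
  refine ⟨F, R, hF, hR, fun u hu => ?_⟩
  obtain ⟨h1, h2⟩ := AffReg.flow0 X hK hu
  have a := hφ u hu 0 le_rfl
  have b := hψ u hu 0 le_rfl
  rw [h2] at a b
  exact ⟨a, b, h1, h2, fun t ht => ⟨hφ u hu t ht, hψ u hu t ht⟩⟩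
end
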